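/- arXiv:1601.06991 — 3 statements merged into one kernel-verified Lean document; each statement's English description precedes it below -/
import Mathlib

section
/- Let (q_n) be a sequence of reals with 0 < q_n < 1 and (1−q_n)^2 · n → 0 as n → ∞, and let (s_n) be a sequence of integers with 1 ≤ s_n ≤ n. For each n let π^{(n)} be a random permutation with the Mallows distribution μ_{n,q_n}. Then the random variables |C_{s_n}(π^{(n)})|/n converge in distribution, as n → ∞, to the uniform distribution on [0,1]; that is, the pushforward laws of |C_{s_n}(π^{(n)})|/n converge weakly to the Lebesgue (uniform) probability measure on [0,1]. -/
open Finset
open scoped Classical BigOperators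

noncomputable section

/-- Number of inversions of a permutation of `Fin n` (0-indexed positions). -/
def invCount (n : ℕ) (π : Equiv.Perm (Fin n)) : ℕ :=
  ((Finset.univ : Finset (Fin n × Fin n)).filter
    (fun p => p.1 < p.2 ∧ π p.2 < π p.1)).card

/-- Normalizing constant of the Mallows distribution. -/
def mallowsZ (n : ℕ) (q : ℝ) : ℝ :=
  ∑ σ : Equiv.Perm (Fin n), q ^ invCount n σ

/-- Mallows probability of an individual permutation. -/
def mallowsP (n : ℕ) (q : ℝ) (π : Equiv.Perm (Fin n)) : ℝ :=
  q ^ invCount n π / mallowsZ n q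

/-- Expectation of a real-valued functional under the Mallows distribution. -/
def mExp (n : ℕ) (q : ℝ) (X : Equiv.Perm (Fin n) → ℝ) : ℝ :=
  ∑ π : Equiv.Perm (Fin n), mallowsP n q π * X π

/-- Probability of an event under the Mallows distribution. -/
def mProb (n : ℕ) (q : ℝ) (A : Equiv.Perm (Fin n) → Prop) : ℝ :=
  ∑ π : Equiv.Perm (Fin n), if A π then mallowsP n q π else 0

/-- Conditional probability of `A` given `B` under the Mallows distribution. -/
def mCondProb (n : ℕ) (q : ℝ) (A B : Equiv.Perm (Fin n) → Prop) : ℝ :=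
  mProb n q (fun π => A π ∧ B π) / mProb n q B

/-- The size of the cycle containing the (1-indexed) point `s ∈ {1,…,n}`.
(For `s` out of range this is a junk value.) -/
def cycleCardNat (n : ℕ) (π : Equiv.Perm (Fin n)) (s : ℕ) : ℕ :=
  (Finset.univ.filter
    (fun t : Fin n => ∃ u : Fin n, (u : ℕ) + 1 = s ∧ π.SameCycle u t)).card


/-! ### Inversions -/

lemma mc_inv_adj (n : ℕ) (π : Equiv.Perm (Fin n)) (i j : Fin n) (h : (j : ℕ) = i + 1) :
    invCount n (π * Equiv.swap i j) ≤ invCount n π + 1 := by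
  unfold invCount
  have hij : i ≠ j := by intro e; rw [e] at h; omega
  set A := (Finset.univ : Finset (Fin n × Fin n)).filter
    (fun p => p.1 < p.2 ∧ (π * Equiv.swap i j) p.2 < (π * Equiv.swap i j) p.1)
  set B := (Finset.univ : Finset (Fin n × Fin n)).filter
    (fun p => p.1 < p.2 ∧ π p.2 < π p.1)
  have h1 : A.card ≤ (A.erase (i, j)).card + 1 := by
    by_cases hm : (i, j) ∈ A
    · rw [Finset.card_erase_of_mem hm]; omega
    · rw [Finset.erase_eq_of_notMem hm]; omega
  have h2 : (A.erase (i, j)).card ≤ B.card := by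
    apply Finset.card_le_card_of_injOn
      (fun p => (Equiv.swap i j p.1, Equiv.swap i j p.2))
    · rintro ⟨x, y⟩ hp
      obtain ⟨hne, hm⟩ := Finset.mem_erase.mp (Finset.mem_coe.mp hp)
      obtain ⟨_, hlt, hinv⟩ := Finset.mem_filter.mp hm
      refine Finset.mem_coe.mpr (Finset.mem_filter.mpr ⟨Finset.mem_univ _, ?_, hinv⟩)
      simp only [ne_eq, Prod.mk.injEq] at hne hlt ⊢
      rw [Equiv.swap_apply_def, Equiv.swap_apply_def]
      rw [Fin.lt_def] at hlt ⊢
      simp only [Fin.ext_iff] at hne ⊢ 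
      split_ifs <;> omega
    · rintro ⟨x, y⟩ _ ⟨x', y'⟩ _ he
      simpa using he
  omega

lemma mc_inv_swap (n : ℕ) (D : ℕ) : ∀ (π : Equiv.Perm (Fin n)) (i j : Fin n),
    (j : ℕ) = i + D → invCount n (π * Equiv.swap i j) ≤ invCount n π + 2 * D := by
  induction D with
  | zero =>
    intro π i j h
    have : i = j := Fin.ext (by omega)
    subst this
    rw [Equiv.swap_self]
    exact le_refl _
  | succ D ih =>
    intro π i j h
    rcases Nat.eq_zero_or_pos D with hD | hD
    · subst hD
      have := mc_inv_adj n π i j (by omega)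
      omega
    have hj := j.isLt
    let k : Fin n := ⟨i + D, by omega⟩
    have hk : (j : ℕ) = k + 1 := by simp [k]; omega
    have hik : i ≠ k := by intro e; have := congrArg Fin.val e; simp [k] at this; omega
    have hij : i ≠ j := by intro e; have := congrArg Fin.val e; omega
    have e : Equiv.swap i j = Equiv.swap k j * Equiv.swap i k * Equiv.swap k j := by
      have := Equiv.swap_mul_swap_mul_swap (x := i) (y := k) (z := j)
        hik hij
      rw [this, Equiv.swap_comm]
    rw [e, ← mul_assoc, ← mul_assoc]
    have a1 := mc_inv_adj n (π * Equiv.swap k j * Equiv.swap i k) k j hk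
    have a2 := ih (π * Equiv.swap k j) i k rfl
    have a3 := mc_inv_adj n π k j hk
    omega

lemma mc_inv_swap' (n : ℕ) (D : ℕ) (π : Equiv.Perm (Fin n)) (i j : Fin n)
    (h1 : (j : ℕ) ≤ i + D) (h2 : (i : ℕ) ≤ j + D) :
    invCount n (π * Equiv.swap i j) ≤ invCount n π + 2 * D := by
  rcases le_total (i : ℕ) j with h | h
  · have := mc_inv_swap n (j - i) π i j (by omega)
    omega
  · have := mc_inv_swap n (i - j) π j i (by omega)
    rw [Equiv.swap_comm] at this
    omega

lemma mc_inv_inv (n : ℕ) (π : Equiv.Perm (Fin n)) : invCount n π⁻¹ = invCount n π := by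
  unfold invCount
  apply Finset.card_bij' (fun p _ => (π⁻¹ p.2, π⁻¹ p.1)) (fun p _ => (π p.2, π p.1))
  all_goals simp +contextual

lemma mc_inv_swap_left (n : ℕ) (D : ℕ) (π : Equiv.Perm (Fin n)) (i j : Fin n)
    (h1 : (j : ℕ) ≤ i + D) (h2 : (i : ℕ) ≤ j + D) :
    invCount n (Equiv.swap i j * π) ≤ invCount n π + 2 * D := by
  rw [← mc_inv_inv n (Equiv.swap i j * π), ← mc_inv_inv n π]
  rw [mul_inv_rev, Equiv.swap_inv]
  exact mc_inv_swap' n D _ i j h1 h2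

/-! ### Weights -/

lemma mc_Z_pos (n : ℕ) (q : ℝ) (hq : 0 < q) : 0 < mallowsZ n q :=
  Finset.sum_pos (fun _ _ => pow_pos hq _) Finset.univ_nonempty

lemma mc_P_pos (n : ℕ) (q : ℝ) (hq : 0 < q) (π : Equiv.Perm (Fin n)) : 0 < mallowsP n q π :=
  div_pos (pow_pos hq _) (mc_Z_pos n q hq)

lemma mc_P_sum (n : ℕ) (q : ℝ) (hq : 0 < q) : ∑ π, mallowsP n q π = 1 := by
  unfold mallowsP
  rw [← Finset.sum_div]
  exact div_self (mc_Z_pos n q hq).ne'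

lemma mc_P_le (n : ℕ) (q : ℝ) (hq : 0 < q) (hq1 : q ≤ 1) (π σ : Equiv.Perm (Fin n)) (D : ℕ)
    (h : invCount n σ ≤ invCount n π + D) : q ^ D * mallowsP n q π ≤ mallowsP n q σ := by
  unfold mallowsP
  rw [← mul_div_assoc, ← pow_add]
  apply div_le_div_of_nonneg_right _ (mc_Z_pos n q hq).le
  exact pow_le_pow_of_le_one hq.le hq1 (by omega)

lemma mc_prob_mono (n : ℕ) (q : ℝ) (hq : 0 < q) (A B : Equiv.Perm (Fin n) → Prop)
    (h : ∀ π, A π → B π) : mProb n q A ≤ mProb n q B := by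
  unfold mProb
  apply Finset.sum_le_sum
  intro π _
  have := (mc_P_pos n q hq π).le
  by_cases hA : A π
  · simp [hA, h π hA]
  · simp only [hA, if_false]; split_ifs <;> simp [this]

lemma mc_prob_nonneg (n : ℕ) (q : ℝ) (hq : 0 < q) (A : Equiv.Perm (Fin n) → Prop) :
    0 ≤ mProb n q A := by
  unfold mProb
  apply Finset.sum_nonneg
  intro π _
  have := (mc_P_pos n q hq π).le
  split_ifs <;> simp [this]

lemma mc_prob_or (n : ℕ) (q : ℝ) (hq : 0 < q) (A B : Equiv.Perm (Fin n) → Prop) :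
    mProb n q (fun π => A π ∨ B π) ≤ mProb n q A + mProb n q B := by
  unfold mProb
  rw [← Finset.sum_add_distrib]
  apply Finset.sum_le_sum
  intro π _
  have := (mc_P_pos n q hq π).le
  by_cases hA : A π <;> by_cases hB : B π <;> simp [hA, hB, this]

lemma mc_prob_exists {ι : Type*} (S : Finset ι) (n : ℕ) (q : ℝ) (hq : 0 < q)
    (A : ι → Equiv.Perm (Fin n) → Prop) :
    mProb n q (fun π => ∃ i ∈ S, A i π) ≤ ∑ i ∈ S, mProb n q (A i) := by
  unfold mProb
  rw [Finset.sum_comm]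
  apply Finset.sum_le_sum
  intro π _
  have hp := (mc_P_pos n q hq π).le
  have hn : ∀ i ∈ S, 0 ≤ if A i π then mallowsP n q π else 0 := by
    intro i _; split_ifs <;> simp [hp]
  by_cases h : ∃ i ∈ S, A i π
  · rw [if_pos h]
    obtain ⟨i, hi, hA⟩ := h
    refine le_trans ?_ (Finset.single_le_sum hn hi)
    simp [hA]
  · rw [if_neg h]; exact Finset.sum_nonneg hn

/-- disjoint events have total probability at most one -/
lemma mc_prob_disj {ι : Type*} (S : Finset ι) (n : ℕ) (q : ℝ) (hq : 0 < q)
    (A : ι → Equiv.Perm (Fin n) → Prop)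
    (hd : ∀ i ∈ S, ∀ j ∈ S, ∀ π, A i π → A j π → i = j) :
    ∑ i ∈ S, mProb n q (A i) ≤ 1 := by
  unfold mProb
  rw [Finset.sum_comm, ← mc_P_sum n q hq]
  apply Finset.sum_le_sum
  intro π _
  have hp := (mc_P_pos n q hq π).le
  by_cases h : ∃ i ∈ S, A i π
  · obtain ⟨i, hi, hA⟩ := h
    rw [Finset.sum_eq_single i]
    · simp [hA]
    · intro j hj hji
      rw [if_neg]
      intro hAj
      exact hji (hd j hj i hi π hAj hA)
    · intro h; exact absurd hi h
  · rw [Finset.sum_eq_zero]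
    · exact hp
    · intro i hi
      rw [if_neg]
      intro hA; exact h ⟨i, hi, hA⟩

lemma mc_transport (n : ℕ) (q : ℝ) (hq : 0 < q) (hq1 : q ≤ 1) (A B : Equiv.Perm (Fin n) → Prop)
    (φ : Equiv.Perm (Fin n) → Equiv.Perm (Fin n)) (hφ : Function.Injective φ) (D : ℕ)
    (hAB : ∀ π, A π → B (φ π)) (hinv : ∀ π, invCount n (φ π) ≤ invCount n π + D) :
    q ^ D * mProb n q A ≤ mProb n q B := by
  unfold mProb
  have hb : Function.Bijective φ := Finite.injective_iff_bijective.mp hφ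
  rw [← (Equiv.ofBijective φ hb).sum_comp (fun π => if B π then mallowsP n q π else 0),
    Finset.mul_sum]
  apply Finset.sum_le_sum
  intro π _
  simp only [Equiv.ofBijective_apply]
  by_cases hA : A π
  · rw [if_pos hA, if_pos (hAB π hA)]
    exact mc_P_le n q hq hq1 _ _ D (hinv π)
  · rw [if_neg hA, mul_zero]
    have := (mc_P_pos n q hq (φ π)).le
    split_ifs <;> simp [this]

/-! ### Exits from an initial segment -/

def mcExit {n : ℕ} (u : ℕ) (t y : Fin n) (π : Equiv.Perm (Fin n)) : Prop :=
  ∃ k : ℕ, 1 ≤ k ∧ (∀ i, 0 < i → i < k → ((π ^ i) t : ℕ) < u) ∧ (π ^ k) t = y ∧ u ≤ (y : ℕ)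

lemma mcExit_unique {n : ℕ} {u : ℕ} {t y y' : Fin n} {π : Equiv.Perm (Fin n)}
    (h : mcExit u t y π) (h' : mcExit u t y' π) : y = y' := by
  obtain ⟨k, hk, h1, h2, h3⟩ := h
  obtain ⟨k', hk', h1', h2', h3'⟩ := h'
  rcases lt_trichotomy k k' with hlt | heq | hlt
  · have := h1' k hk hlt; rw [h2] at this; omega
  · rw [← h2, ← h2', heq]
  · have := h1 k' hk' hlt; rw [h2'] at this; omega

lemma mcExit_left {n : ℕ} {u : ℕ} {t y : Fin n} {π : Equiv.Perm (Fin n)} (a b : Fin n)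
    (ha : u ≤ (a : ℕ)) (hb : u ≤ (b : ℕ))
    (h : mcExit u t y π) : mcExit u t (Equiv.swap a b y) (Equiv.swap a b * π) := by
  obtain ⟨k, hk, h1, h2, h3⟩ := h
  have hfix : ∀ z : Fin n, (z : ℕ) < u → Equiv.swap a b z = z := by
    intro z hz
    apply Equiv.swap_apply_of_ne_of_ne <;> (intro e; rw [e] at hz; omega)
  have key : ∀ i, i < k → ((Equiv.swap a b * π) ^ i) t = (π ^ i) t := by
    intro i
    induction i with
    | zero => intro _; simp
    | succ i ih =>
      intro hi
      rw [pow_succ', Equiv.Perm.mul_apply, ih (by omega), Equiv.Perm.mul_apply,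
        ← Equiv.Perm.mul_apply π, ← pow_succ']
      exact hfix _ (h1 _ (by omega) hi)
  refine ⟨k, hk, ?_, ?_, ?_⟩
  · intro i hi hik; rw [key i hik]; exact h1 i hi hik
  · obtain ⟨k, rfl⟩ : ∃ m, k = m + 1 := ⟨k - 1, by omega⟩
    rw [pow_succ', Equiv.Perm.mul_apply, key k (by omega), Equiv.Perm.mul_apply,
        ← Equiv.Perm.mul_apply π, ← pow_succ', h2]
  · rw [Equiv.swap_apply_def]; split_ifs <;> omega

lemma mcExit_right {n : ℕ} {u : ℕ} {t y : Fin n} {π : Equiv.Perm (Fin n)} (a b : Fin n)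
    (ha : u ≤ (a : ℕ)) (hb : u ≤ (b : ℕ)) (ht : (t : ℕ) < u)
    (h : mcExit u t y π) : mcExit u t y (π * Equiv.swap a b) := by
  obtain ⟨k, hk, h1, h2, h3⟩ := h
  have hfix : ∀ z : Fin n, (z : ℕ) < u → Equiv.swap a b z = z := by
    intro z hz
    apply Equiv.swap_apply_of_ne_of_ne <;> (intro e; rw [e] at hz; omega)
  have key : ∀ i, i ≤ k → ((π * Equiv.swap a b) ^ i) t = (π ^ i) t := by
    intro i
    induction i with
    | zero => intro _; simp
    | succ i ih =>
      intro hi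
      rw [pow_succ', Equiv.Perm.mul_apply, ih (by omega), Equiv.Perm.mul_apply, hfix,
        ← Equiv.Perm.mul_apply π, ← pow_succ']
      rcases Nat.eq_zero_or_pos i with h0 | h0
      · subst h0; simpa using ht
      · exact h1 i h0 (by omega)
  refine ⟨k, hk, ?_, ?_, h3⟩
  · intro i hi hik; rw [key i hik.le]; exact h1 i hi hik
  · rw [key k le_rfl, h2]

lemma mc_single (n : ℕ) (q : ℝ) (hq : 0 < q) (hq1 : q ≤ 1) (K u : ℕ) (hu : u + K ≤ n)
    (t y : Fin n) (hy : u ≤ (y : ℕ)) (hy' : (y : ℕ) < u + K) :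
    q ^ (2 * K) * K * mProb n q (mcExit u t y) ≤ 1 := by
  have h1 : ∀ j : Fin K, q ^ (2 * K) * mProb n q (mcExit u t y) ≤
      mProb n q (mcExit u t ⟨u + j, by omega⟩) := by
    intro j
    have hj := j.isLt
    apply mc_transport n q hq hq1 _ _ (fun π => Equiv.swap y ⟨u + j, by omega⟩ * π)
      (mul_right_injective _)
    · intro π h
      have := mcExit_left y ⟨u + j, by omega⟩ hy (by simp) h
      rwa [Equiv.swap_apply_left] at this
    · intro π
      apply mc_inv_swap_left
      · simp; omega
      · simp; omega
  have h2 := mc_prob_disj (Finset.univ : Finset (Fin K)) n q hq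
    (fun j => mcExit u t ⟨u + j, by omega⟩) (by
      intro i _ j _ π hi hj
      have := congrArg Fin.val (mcExit_unique hi hj)
      simp at this
      exact Fin.ext this)
  have h3 := Finset.sum_le_sum (fun j (_ : j ∈ (Finset.univ : Finset (Fin K))) => h1 j)
  simp only [Finset.sum_const, Finset.card_univ, Fintype.card_fin, nsmul_eq_mul] at h3
  calc _ = (K : ℝ) * (q ^ (2 * K) * mProb n q (mcExit u t y)) := by ring
    _ ≤ _ := h3.trans h2

lemma mc_single_inv (n : ℕ) (q : ℝ) (hq : 0 < q) (hq1 : q ≤ 1) (K u : ℕ) (hu : u + K ≤ n)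
    (t y : Fin n) (hy : u ≤ (y : ℕ)) (hy' : (y : ℕ) < u + K) :
    q ^ (2 * K) * K * mProb n q (fun π => mcExit u t y π⁻¹) ≤ 1 := by
  refine le_trans ?_ (mc_single n q hq hq1 K u hu t y hy hy')
  apply mul_le_mul_of_nonneg_left _ (by positivity)
  have := mc_transport n q hq hq1 (fun π => mcExit u t y π⁻¹) (mcExit u t y) (fun π => π⁻¹)
    inv_injective 0 (fun π h => h) (fun π => by rw [mc_inv_inv]; simp)
  simpa using this

lemma mc_double (n : ℕ) (q : ℝ) (hq : 0 < q) (hq1 : q ≤ 1) (K : ℕ) (u : Fin n)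
    (hu : (u : ℕ) + K ≤ n) (t t' : Fin n) (ht : (t : ℕ) < u) (ht' : (t' : ℕ) < u) :
    q ^ (4 * K) * K ^ 2 * mProb n q (fun π => mcExit u t u π ∧ mcExit u t' u π⁻¹) ≤ 1 := by
  let f : Fin K → Fin n := fun j => ⟨u + j, by omega⟩
  have h1 : ∀ p : Fin K × Fin K,
      q ^ (4 * K) * mProb n q (fun π => mcExit u t u π ∧ mcExit u t' u π⁻¹) ≤
      mProb n q (fun π => mcExit u t (f p.1) π ∧ mcExit u t' (f p.2) π⁻¹) := by
    rintro ⟨i, j⟩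
    apply mc_transport n q hq hq1 _ _ (fun π => Equiv.swap u (f i) * π * Equiv.swap u (f j))
    · intro a b h
      simpa using h
    · rintro π ⟨ha, hb⟩
      have a1 := mcExit_left u (f i) le_rfl (by simp [f]) ha
      rw [Equiv.swap_apply_left] at a1
      have a2 := mcExit_right u (f j) le_rfl (by simp [f]) ht a1
      refine ⟨a2, ?_⟩
      have b1 := mcExit_left u (f j) le_rfl (by simp [f]) hb
      rw [Equiv.swap_apply_left] at b1
      have b2 := mcExit_right u (f i) le_rfl (by simp [f]) ht' b1
      simpa [mul_assoc] using b2
    · intro π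
      have c1 := mc_inv_swap' n K (Equiv.swap u (f i) * π) u (f j)
        (by have := j.isLt; simp only [f]; omega) (by simp only [f]; omega)
      have c2 := mc_inv_swap_left n K π u (f i)
        (by have := i.isLt; simp only [f]; omega) (by simp only [f]; omega)
      omega
  have h2 := mc_prob_disj (Finset.univ : Finset (Fin K × Fin K)) n q hq
    (fun p π => mcExit u t (f p.1) π ∧ mcExit u t' (f p.2) π⁻¹) (by
      rintro ⟨i, j⟩ _ ⟨i', j'⟩ _ π ⟨hi, hj⟩ ⟨hi', hj'⟩
      have e1 := congrArg Fin.val (mcExit_unique hi hi')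
      have e2 := congrArg Fin.val (mcExit_unique hj hj')
      simp [f] at e1 e2
      exact Prod.ext (Fin.ext e1) (Fin.ext e2))
  have h3 := Finset.sum_le_sum
    (fun j (_ : j ∈ (Finset.univ : Finset (Fin K × Fin K))) => h1 j)
  simp only [Finset.sum_const, Finset.card_univ, Fintype.card_prod, Fintype.card_fin,
    nsmul_eq_mul] at h3
  push_cast at h3
  calc _ = ((K : ℝ) * K) * (q ^ (4 * K) * mProb n q
        (fun π => mcExit u t u π ∧ mcExit u t' u π⁻¹)) := by ring
    _ ≤ _ := h3.trans h2

/-- The second point is reached from the first by a nontrivial path inside the segment. -/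
def mcReach {n : ℕ} (T : ℕ) (t t' : Fin n) (π : Equiv.Perm (Fin n)) : Prop :=
  ∃ k : ℕ, 1 ≤ k ∧ (∀ i, i ≤ k → ((π ^ i) t : ℕ) < T) ∧ (π ^ k) t = t'

lemma mcReach_cases {n : ℕ} {T : ℕ} {t t' : Fin n} {π : Equiv.Perm (Fin n)}
    (h : mcReach T t t' π) :
    mcExit t' t t' π ∨ mcExit t t' t π⁻¹ ∨
      ∃ v ∈ (Finset.univ.filter (fun v : Fin n => (v : ℕ) < T ∧ t < v ∧ t' < v)),
        mcExit v t v π ∧ mcExit v t' v π⁻¹ := by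
  obtain ⟨k, hk, hT, hkt⟩ := h
  obtain ⟨m, hm, hmax⟩ := Finset.exists_max_image (Finset.range (k + 1))
    (fun i => (π ^ i) t) ⟨0, by simp⟩
  set v := (π ^ m) t with hv
  have hmk : m ≤ k := by simpa [Nat.lt_succ_iff] using hm
  have hmax' : ∀ i, i ≤ k → (π ^ i) t ≤ v := fun i hi =>
    hmax i (by simp; omega)
  have hback : ∀ i, i ≤ k → (π⁻¹ ^ i) t' = (π ^ (k - i)) t := by
    intro i hi
    rw [← hkt, inv_pow, Equiv.Perm.inv_eq_iff_eq, ← Equiv.Perm.mul_apply, ← pow_add]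
    congr 2; omega
  -- forward exit
  have fwd : (∃ i, 1 ≤ i ∧ i ≤ k ∧ (π ^ i) t = v) → mcExit v t v π := by
    intro hex
    have h1 := Nat.find_spec hex
    refine ⟨Nat.find hex, h1.1, ?_, h1.2.2, le_rfl⟩
    intro i hi hlt
    have h2 := Nat.find_min hex hlt
    have h3 := hmax' i (by omega)
    rcases lt_or_eq_of_le h3 with h4 | h4
    · exact h4
    · exact absurd ⟨hi, by omega, h4⟩ h2
  have bwd : (∃ i, 1 ≤ i ∧ i ≤ k ∧ (π⁻¹ ^ i) t' = v) → mcExit v t' v π⁻¹ := by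
    intro hex
    have h1 := Nat.find_spec hex
    refine ⟨Nat.find hex, h1.1, ?_, h1.2.2, le_rfl⟩
    intro i hi hlt
    have h2 := Nat.find_min hex hlt
    have hik : i ≤ k := by omega
    have h3 := hmax' (k - i) (by omega)
    rw [← hback i hik] at h3
    rcases lt_or_eq_of_le h3 with h4 | h4
    · exact h4
    · exact absurd ⟨hi, by omega, h4⟩ h2
  by_cases e1 : v = t'
  · left
    rw [← e1]
    exact fwd ⟨k, hk, le_rfl, by rw [hkt, e1]⟩
  · by_cases e2 : v = t
    · right; left
      rw [← e2]
      exact bwd ⟨k, hk, le_rfl, by rw [hback k le_rfl, e2]; simp⟩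
    · right; right
      refine ⟨v, ?_, fwd ?_, bwd ?_⟩
      · simp only [Finset.mem_filter, Finset.mem_univ, true_and]
        refine ⟨hT m hmk, ?_, ?_⟩
        · have := hmax' 0 (by omega)
          simp only [pow_zero, Equiv.Perm.one_apply] at this
          exact lt_of_le_of_ne this (Ne.symm e2)
        · have := hmax' k le_rfl
          rw [hkt] at this
          exact lt_of_le_of_ne this (Ne.symm e1)
      · refine ⟨m, ?_, hmk, rfl⟩
        rcases Nat.eq_zero_or_pos m with h0 | h0
        · exfalso; apply e2; rw [hv, h0]; simp
        · exact h0
      · refine ⟨k - m, ?_, by omega, ?_⟩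
        · rcases Nat.lt_or_ge m k with h0 | h0
          · omega
          · exfalso; apply e1; rw [hv, le_antisymm hmk h0, hkt]
        · rw [hback _ (by omega), hv]; congr 2; omega

/-- the basic error term -/
def mcDelta (n : ℕ) (q : ℝ) (K : ℕ) : ℝ := 2 / (q ^ (2 * K) * K) + n / (q ^ (4 * K) * K ^ 2)

lemma mc_reach_prob (n : ℕ) (q : ℝ) (hq : 0 < q) (hq1 : q ≤ 1) (K T : ℕ) (hK : 1 ≤ K)
    (hT : T + K ≤ n) (t t' : Fin n) (ht : (t : ℕ) < T) (ht' : (t' : ℕ) < T) :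
    mProb n q (mcReach T t t') ≤ mcDelta n q K := by
  have hKr : (0 : ℝ) < K := by exact_mod_cast hK
  have c2 : 0 < q ^ (2 * K) * (K : ℝ) := by positivity
  have c4 : 0 < q ^ (4 * K) * (K : ℝ) ^ 2 := by positivity
  have a1 : mProb n q (mcExit t' t t') ≤ 1 / (q ^ (2 * K) * K) := by
    rw [le_div_iff₀ c2, mul_comm]
    exact mc_single n q hq hq1 K t' (by omega) t t' le_rfl (by omega)
  have a2 : mProb n q (fun π => mcExit t t' t π⁻¹) ≤ 1 / (q ^ (2 * K) * K) := by
    rw [le_div_iff₀ c2, mul_comm]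
    exact mc_single_inv n q hq hq1 K t (by omega) t' t le_rfl (by omega)
  have a3 := mc_prob_exists (Finset.univ.filter (fun v : Fin n => (v : ℕ) < T ∧ t < v ∧ t' < v))
    n q hq (fun v π => mcExit v t v π ∧ mcExit v t' v π⁻¹)
  have a4 : ∑ v ∈ (Finset.univ.filter (fun v : Fin n => (v : ℕ) < T ∧ t < v ∧ t' < v)),
      mProb n q (fun π => mcExit v t v π ∧ mcExit v t' v π⁻¹) ≤
        n / (q ^ (4 * K) * K ^ 2) := by
    refine (Finset.sum_le_card_nsmul _ _ (1 / (q ^ (4 * K) * K ^ 2)) ?_).trans ?_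
    · intro v hv
      simp only [Finset.mem_filter, Finset.mem_univ, true_and] at hv
      rw [le_div_iff₀ c4, mul_comm]
      exact mc_double n q hq hq1 K v (by omega) t t' hv.2.1 hv.2.2
    · rw [nsmul_eq_mul, mul_one_div]
      apply div_le_div_of_nonneg_right _ c4.le
      have := Finset.card_filter_le (Finset.univ : Finset (Fin n))
        (fun v : Fin n => (v : ℕ) < T ∧ t < v ∧ t' < v)
      simp only [Finset.card_univ, Fintype.card_fin] at this
      exact_mod_cast this
  refine (mc_prob_mono n q hq _ _ (fun π h => mcReach_cases h)).trans ?_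
  refine (mc_prob_or n q hq _ _).trans ?_
  have b := mc_prob_or n q hq (fun π => mcExit t t' t π⁻¹) (fun π =>
      ∃ v ∈ (Finset.univ.filter (fun v : Fin n => (v : ℕ) < T ∧ t < v ∧ t' < v)),
        mcExit v t v π ∧ mcExit v t' v π⁻¹)
  have e : mcDelta n q K = 1 / (q ^ (2 * K) * K) + (1 / (q ^ (2 * K) * K)
      + n / (q ^ (4 * K) * K ^ 2)) := by unfold mcDelta; ring
  rw [e]
  linarith

/-! ### First hitting of the final window and the switching map -/

def mcHit {n : ℕ} (T : ℕ) (x : Fin n) (k : ℕ) (y : Fin n) (π : Equiv.Perm (Fin n)) : Prop :=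
  (∀ i, i < k → ((π ^ i) x : ℕ) < T) ∧ (π ^ k) x = y ∧ T ≤ (y : ℕ)

lemma mcHit_unique {n : ℕ} {T : ℕ} {x y y' : Fin n} {k k' : ℕ} {π : Equiv.Perm (Fin n)}
    (h : mcHit T x k y π) (h' : mcHit T x k' y' π) : k = k' ∧ y = y' := by
  obtain ⟨h1, h2, h3⟩ := h
  obtain ⟨h1', h2', h3'⟩ := h'
  rcases lt_trichotomy k k' with hlt | heq | hlt
  · have := h1' k hlt; rw [h2] at this; omega
  · exact ⟨heq, by rw [← h2, ← h2', heq]⟩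
  · have := h1 k' hlt; rw [h2'] at this; omega

lemma mcHit_shift {n : ℕ} {T : ℕ} {x y : Fin n} {k : ℕ} {π : Equiv.Perm (Fin n)}
    (h : mcHit T x k y π) (i : ℕ) (hi : i ≤ k) : mcHit T ((π ^ i) x) (k - i) y π := by
  obtain ⟨h1, h2, h3⟩ := h
  refine ⟨?_, ?_, h3⟩
  · intro j hj
    rw [← Equiv.Perm.mul_apply, ← pow_add]
    exact h1 _ (by omega)
  · rw [← Equiv.Perm.mul_apply, ← pow_add, ← h2]
    congr 2; omega

lemma mcHit_right {n : ℕ} {T : ℕ} {x y : Fin n} {k : ℕ} {π : Equiv.Perm (Fin n)} (a b : Fin n)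
    (ha : T ≤ (a : ℕ)) (hb : T ≤ (b : ℕ)) (h : mcHit T x k y π) :
    mcHit T x k y (π * Equiv.swap a b) := by
  obtain ⟨h1, h2, h3⟩ := h
  have hfix : ∀ z : Fin n, (z : ℕ) < T → Equiv.swap a b z = z := by
    intro z hz
    apply Equiv.swap_apply_of_ne_of_ne <;> (intro e; rw [e] at hz; omega)
  have key : ∀ i, i ≤ k → ((π * Equiv.swap a b) ^ i) x = (π ^ i) x := by
    intro i
    induction i with
    | zero => intro _; simp
    | succ i ih =>
      intro hi
      rw [pow_succ', Equiv.Perm.mul_apply, ih (by omega), Equiv.Perm.mul_apply,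
        hfix _ (h1 i (by omega)), ← Equiv.Perm.mul_apply π, ← pow_succ']
  refine ⟨?_, ?_, h3⟩
  · intro i hik; rw [key i hik.le]; exact h1 i hik
  · rw [key k le_rfl, h2]

def mcTau {n : ℕ} (T : ℕ) (x : Fin n) (π : Equiv.Perm (Fin n)) : ℕ :=
  if h : ∃ k : ℕ, T ≤ ((π ^ k) x : ℕ) then Nat.find h else 0

def mcExt {n : ℕ} (T : ℕ) (x : Fin n) (π : Equiv.Perm (Fin n)) : Fin n :=
  (π ^ mcTau T x π) x

lemma mcHit_of_exists {n : ℕ} {T : ℕ} {x : Fin n} {π : Equiv.Perm (Fin n)}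
    (h : ∃ k : ℕ, T ≤ ((π ^ k) x : ℕ)) : mcHit T x (mcTau T x π) (mcExt T x π) π := by
  have e : mcTau T x π = Nat.find h := by unfold mcTau; rw [dif_pos h]
  unfold mcExt
  rw [e]
  refine ⟨?_, rfl, Nat.find_spec h⟩
  intro i hi
  have := Nat.find_min h hi
  omega

lemma mcHit_eq {n : ℕ} {T : ℕ} {x y : Fin n} {k : ℕ} {π : Equiv.Perm (Fin n)}
    (h : mcHit T x k y π) : k = mcTau T x π ∧ y = mcExt T x π :=
  mcHit_unique h (mcHit_of_exists ⟨k, by rw [h.2.1]; exact h.2.2⟩)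

/-- the good event -/
def mcG {n : ℕ} (T : ℕ) (s t : Fin n) (π : Equiv.Perm (Fin n)) : Prop :=
  mcHit T s (mcTau T s π) (mcExt T s π) π ∧ mcHit T t (mcTau T t π) (mcExt T t π) π ∧
    mcExt T s π ≠ mcExt T t π

def mcTheta {n : ℕ} (T : ℕ) (s t : Fin n) (π : Equiv.Perm (Fin n)) : Equiv.Perm (Fin n) :=
  π * Equiv.swap (mcExt T s π) (mcExt T t π)

lemma mcG_theta {n : ℕ} {T : ℕ} {s t : Fin n} {π : Equiv.Perm (Fin n)} (h : mcG T s t π) :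
    mcG T s t (mcTheta T s t π) ∧ mcExt T s (mcTheta T s t π) = mcExt T s π ∧
      mcExt T t (mcTheta T s t π) = mcExt T t π ∧ mcTheta T s t (mcTheta T s t π) = π := by
  obtain ⟨h1, h2, h3⟩ := h
  have a1 : mcHit T s (mcTau T s π) (mcExt T s π) (mcTheta T s t π) :=
    mcHit_right _ _ h1.2.2 h2.2.2 h1
  have a2 : mcHit T t (mcTau T t π) (mcExt T t π) (mcTheta T s t π) :=
    mcHit_right _ _ h1.2.2 h2.2.2 h2
  have e1 := mcHit_eq a1
  have e2 := mcHit_eq a2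
  refine ⟨⟨?_, ?_, ?_⟩, e1.2.symm, e2.2.symm, ?_⟩
  · rw [← e1.1, ← e1.2]; exact a1
  · rw [← e2.1, ← e2.2]; exact a2
  · rw [← e1.2, ← e2.2]; exact h3
  · show mcTheta T s t π * Equiv.swap (mcExt T s (mcTheta T s t π))
      (mcExt T t (mcTheta T s t π)) = π
    rw [← e1.2, ← e2.2]
    unfold mcTheta
    rw [mul_assoc, Equiv.swap_mul_self, mul_one]

lemma mc_swap_path {n : ℕ} (π : Equiv.Perm (Fin n)) (a b : Fin n) (r : ℕ)
    (h : ∀ i, 0 < i → i < r → (π ^ i) b ≠ a ∧ (π ^ i) b ≠ b) :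
    ∀ i, 1 ≤ i → i ≤ r → ((π * Equiv.swap a b) ^ i) a = (π ^ i) b := by
  intro i hi
  induction i, hi using Nat.le_induction with
  | base => intro _; simp
  | succ i hi ih =>
    intro hir
    have := h i hi (by omega)
    rw [pow_succ', Equiv.Perm.mul_apply, ih (by omega), Equiv.Perm.mul_apply,
      Equiv.swap_apply_of_ne_of_ne this.1 this.2, ← Equiv.Perm.mul_apply π, ← pow_succ']

lemma mc_sameCycle_nat {n : ℕ} {π : Equiv.Perm (Fin n)} {a b : Fin n} :
    π.SameCycle a b ↔ ∃ k : ℕ, (π ^ k) a = b := by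
  constructor
  · intro h
    obtain ⟨i, _, h⟩ := h.exists_pow_eq'
    exact ⟨_, h⟩
  · rintro ⟨k, h⟩
    exact ⟨k, by simpa using h⟩

lemma mc_iter {n : ℕ} (π : Equiv.Perm (Fin n)) (k : ℕ) (x : Fin n) :
    (⇑π)^[k] x = (π ^ k) x := by
  rw [← Equiv.Perm.iterate_eq_pow]

lemma mc_minPer_eq {n : ℕ} (π : Equiv.Perm (Fin n)) (x : Fin n) (r : ℕ) (hr : 1 ≤ r)
    (h : (π ^ r) x = x) (hmin : ∀ i, 0 < i → i < r → (π ^ i) x ≠ x) :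
    Function.minimalPeriod π x = r := by
  have hp : Function.IsPeriodicPt π r x := by
    unfold Function.IsPeriodicPt Function.IsFixedPt; rw [mc_iter]; exact h
  apply le_antisymm (hp.minimalPeriod_le hr)
  by_contra hlt
  push Not at hlt
  apply hmin _ (hp.minimalPeriod_pos hr) hlt
  rw [← mc_iter]
  exact Function.iterate_minimalPeriod

lemma mc_minPer_pos {n : ℕ} (π : Equiv.Perm (Fin n)) (x : Fin n) :
    0 < Function.minimalPeriod π x := by
  have hp : Function.IsPeriodicPt π (orderOf π) x := by
    unfold Function.IsPeriodicPt Function.IsFixedPt; rw [mc_iter, pow_orderOf_eq_one]; rfl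
  exact hp.minimalPeriod_pos (orderOf_pos π)

lemma mc_minPer_shift {n : ℕ} (π : Equiv.Perm (Fin n)) (x : Fin n) (k : ℕ) :
    Function.minimalPeriod π ((π ^ k) x) = Function.minimalPeriod π x := by
  rw [← mc_iter]
  exact Function.minimalPeriod_apply_iterate
    (Function.mem_periodicPts.mpr ⟨_, mc_minPer_pos π x, Function.isPeriodicPt_minimalPeriod _ _⟩) k

lemma mc_split {n : ℕ} (π : Equiv.Perm (Fin n)) (a b : Fin n) (r : ℕ) (hr : 1 ≤ r)
    (h : (π ^ r) b = a) (hab : a ≠ b) (hmin : ∀ i, i < r → (π ^ i) b ≠ a) :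
    Function.minimalPeriod (π * Equiv.swap a b) a = r ∧
      ¬ (π * Equiv.swap a b).SameCycle a b := by
  have hb : ∀ i, 0 < i → i ≤ r → (π ^ i) b ≠ b := by
    intro i hi hir e
    apply hmin (r - i) (by omega)
    rw [← h]
    conv_rhs => rw [show r = (r - i) + i by omega, pow_add, Equiv.Perm.mul_apply, e]
  have hp := mc_swap_path π a b r (fun i hi hir => ⟨hmin i hir, hb i hi hir.le⟩)
  have hper : ((π * Equiv.swap a b) ^ r) a = a := by rw [hp r hr le_rfl, h]
  refine ⟨mc_minPer_eq _ _ r hr hper ?_, ?_⟩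
  · intro i hi hir
    rw [hp i hi hir.le]
    exact hmin i hir
  · intro hs
    obtain ⟨k, hk⟩ := mc_sameCycle_nat.mp hs
    have hpp : Function.IsPeriodicPt (π * Equiv.swap a b) r a := by
      unfold Function.IsPeriodicPt Function.IsFixedPt; rw [mc_iter]; exact hper
    have := hpp.iterate_mod_apply k
    rw [mc_iter, mc_iter, hk] at this
    have hlt := Nat.mod_lt k hr
    rcases Nat.eq_zero_or_pos (k % r) with h0 | h0
    · rw [h0] at this; exact hab (by simpa using this)
    · rw [hp _ h0 hlt.le] at this
      exact hb _ h0 hlt.le this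

lemma mc_merge {n : ℕ} (π : Equiv.Perm (Fin n)) (a b : Fin n)
    (h : ¬ π.SameCycle a b) : (π * Equiv.swap a b).SameCycle a b := by
  have hpos := mc_minPer_pos π b
  have hp := mc_swap_path π a b (Function.minimalPeriod π b) (fun i hi hir => ⟨fun e => by
    apply h; exact (mc_sameCycle_nat.mpr ⟨i, e⟩).symm, fun e => by
    have : Function.IsPeriodicPt π i b := by
      unfold Function.IsPeriodicPt Function.IsFixedPt; rw [mc_iter]; exact e
    have := this.minimalPeriod_le hi
    omega⟩)
  refine mc_sameCycle_nat.mpr ⟨_, (hp _ hpos le_rfl).trans ?_⟩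
  rw [← mc_iter]
  exact Function.iterate_minimalPeriod

/-- number of steps from `t` to `s` -/
def mcDist {n : ℕ} (t s : Fin n) (π : Equiv.Perm (Fin n)) : ℕ :=
  if h : ∃ k : ℕ, (π ^ k) t = s then Nat.find h else 0

lemma mcDist_spec {n : ℕ} {t s : Fin n} {π : Equiv.Perm (Fin n)} (h : π.SameCycle s t) :
    (π ^ mcDist t s π) t = s ∧ ∀ k, (π ^ k) t = s → mcDist t s π ≤ k := by
  have h' := mc_sameCycle_nat.mp h.symm
  have e : mcDist t s π = Nat.find h' := by unfold mcDist; rw [dif_pos h']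
  rw [e]
  exact ⟨Nat.find_spec h', fun k hk => Nat.find_min' h' hk⟩

lemma mc_same_ext {n : ℕ} {T : ℕ} {s t : Fin n} {π : Equiv.Perm (Fin n)} (_h : mcG T s t π) :
    π.SameCycle (mcExt T s π) (mcExt T t π) ↔ π.SameCycle s t := by
  unfold mcExt
  simp

lemma mc_split_G {n : ℕ} {T : ℕ} {s t : Fin n} {π : Equiv.Perm (Fin n)} (h : mcG T s t π)
    (hs : π.SameCycle s t) :
    Function.minimalPeriod (mcTheta T s t π) s + mcTau T t π = mcDist t s π + mcTau T s π ∧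
      ¬ (mcTheta T s t π).SameCycle s t := by
  have hT := mcG_theta h
  have hse := (mc_same_ext h).mpr hs
  obtain ⟨h1, h2, h3⟩ := h
  set a := mcExt T s π with ha
  set b := mcExt T t π with hb
  have hex := mc_sameCycle_nat.mp hse.symm
  set r := Nat.find hex with hr
  have hr1 : (π ^ r) b = a := Nat.find_spec hex
  have hrmin : ∀ i, i < r → (π ^ i) b ≠ a := fun i hi => Nat.find_min hex hi
  have hrpos : 1 ≤ r := by
    rcases Nat.eq_zero_or_pos r with h0 | h0
    · rw [h0] at hr1; exact absurd (by simpa using hr1.symm) h3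
    · exact h0
  obtain ⟨hp, hns⟩ := mc_split π a b r hrpos hr1 h3 hrmin
  have hth : mcTheta T s t π = π * Equiv.swap a b := rfl
  have hper : Function.minimalPeriod (mcTheta T s t π) s = r := by
    have := (mcHit_right (a := a) (b := b) h1.2.2 h2.2.2 h1).2.1
    have h5 := mc_minPer_shift (π * Equiv.swap a b) s (mcTau T s π)
    rw [this] at h5
    rw [hth, ← h5]
    exact hp
  constructor
  · rw [hper]
    obtain ⟨d1, d2⟩ := mcDist_spec hs
    set D := mcDist t s π
    set k1 := mcTau T s π
    set k2 := mcTau T t π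
    have hk2 : k2 < D := by
      by_contra hcon
      push Not at hcon
      have := mcHit_shift h2 D hcon
      rw [d1] at this
      exact h3 (mcHit_unique h1 this).2
    have u1 : r ≤ D + k1 - k2 := by
      by_contra hcon
      push Not at hcon
      apply hrmin _ hcon
      rw [← h2.2.1, ← Equiv.Perm.mul_apply, ← pow_add, ← h1.2.1,
        show D + k1 - k2 + k2 = k1 + D by omega, pow_add, Equiv.Perm.mul_apply, d1]
    have e : (π ^ (k2 + r)) t = (π ^ k1) s := by
      rw [add_comm, pow_add, Equiv.Perm.mul_apply, h2.2.1, hr1, h1.2.1]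
    rcases le_or_gt k1 (k2 + r) with hle | hlt
    · have : (π ^ (k2 + r - k1)) t = s := by
        apply (π ^ k1).injective
        rw [← e, ← Equiv.Perm.mul_apply, ← pow_add]
        congr 2; omega
      have := d2 _ this
      omega
    · exfalso
      have : (π ^ (k1 - (k2 + r))) s = t := by
        apply (π ^ (k2 + r)).injective
        rw [e, ← Equiv.Perm.mul_apply, ← pow_add]
        congr 2; omega
      have h4 := mcHit_shift h1 (k1 - (k2 + r)) (by omega)
      rw [this] at h4
      exact h3 (mcHit_unique h4 h2).2
  · intro hc
    have := (mc_same_ext hT.1).mpr hc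
    rw [hT.2.1, hT.2.2.1] at this
    exact hns this

lemma mc_theta_same {n : ℕ} {T : ℕ} {s t : Fin n} {π : Equiv.Perm (Fin n)} (h : mcG T s t π) :
    (mcTheta T s t π).SameCycle s t ↔ ¬ π.SameCycle s t := by
  constructor
  · intro h1 h2
    exact (mc_split_G h h2).2 h1
  · intro h1
    have hT := mcG_theta h
    have h2 : ¬ π.SameCycle (mcExt T s π) (mcExt T t π) := fun hc => h1 ((mc_same_ext h).mp hc)
    have h3 := mc_merge π _ _ h2
    have h4 : (mcTheta T s t π).SameCycle (mcExt T s (mcTheta T s t π))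
        (mcExt T t (mcTheta T s t π)) := by
      rw [hT.2.1, hT.2.2.1]; exact h3
    exact (mc_same_ext hT.1).mp h4

lemma mc_reach_self {n : ℕ} {T : ℕ} {x : Fin n} {π : Equiv.Perm (Fin n)}
    (h : ¬ ∃ k : ℕ, T ≤ ((π ^ k) x : ℕ)) : mcReach T x x π := by
  push Not at h
  exact ⟨orderOf π, orderOf_pos π, fun i _ => h i, by rw [pow_orderOf_eq_one]; rfl⟩

lemma mc_bad {n : ℕ} {T : ℕ} {s t : Fin n} {π : Equiv.Perm (Fin n)} (hst : t ≠ s)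
    (ht : (t : ℕ) < T) (h : ¬ mcG T s t π) :
    mcReach T t t π ∨ ((s : ℕ) < T ∧ mcReach T s s π) ∨ ((s : ℕ) < T ∧ mcReach T t s π) ∨
      ((s : ℕ) < T ∧ mcReach T s t π) ∨ (T ≤ (s : ℕ) ∧ mcExit T t s π) := by
  by_cases e1 : ∃ k : ℕ, T ≤ ((π ^ k) t : ℕ)
  swap
  · exact Or.inl (mc_reach_self e1)
  by_cases e2 : ∃ k : ℕ, T ≤ ((π ^ k) s : ℕ)
  swap
  · right; left
    refine ⟨?_, mc_reach_self e2⟩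
    push Not at e2
    exact e2 0
  right; right
  have h1 := mcHit_of_exists e2
  have h2 := mcHit_of_exists e1
  have h3 : mcExt T s π = mcExt T t π := by
    by_contra hc
    exact h ⟨h1, h2, hc⟩
  set k1 := mcTau T s π
  set k2 := mcTau T t π
  have e : (π ^ k1) s = (π ^ k2) t := h3
  have hk2 : 0 < k2 := by
    rcases Nat.eq_zero_or_pos k2 with h0 | h0
    · have a := h2.2.1
      have b := h2.2.2
      rw [← a, h0] at b
      simp at b
      omega
    · exact h0
  rcases lt_trichotomy k1 k2 with hlt | heq | hlt
  · have hs : (π ^ (k2 - k1)) t = s := by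
      apply (π ^ k1).injective
      rw [e, ← Equiv.Perm.mul_apply, ← pow_add]
      congr 2; omega
    rcases Nat.eq_zero_or_pos k1 with h0 | h0
    · right; right
      have a := h1.2.1
      have b := h1.2.2
      rw [← a, h0] at b
      simp only [pow_zero, Equiv.Perm.one_apply] at b
      refine ⟨b, k2, hk2, fun i _ hi => h2.1 i hi, ?_, b⟩
      rw [h0] at hs
      exact hs
    · left
      exact ⟨h1.1 0 h0, k2 - k1, by omega, fun i hi => h2.1 i (by omega), hs⟩
  · exfalso
    rw [heq] at e
    exact hst ((π ^ k2).injective e).symm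
  · right; left
    have hs : (π ^ (k1 - k2)) s = t := by
      apply (π ^ k2).injective
      rw [← e, ← Equiv.Perm.mul_apply, ← pow_add]
      congr 2; omega
    exact ⟨h1.1 0 (by omega), k1 - k2, by omega, fun i hi => h1.1 i (by omega), hs⟩

lemma mc_tau_le {n : ℕ} {T : ℕ} {x y : Fin n} {k : ℕ} {π : Equiv.Perm (Fin n)}
    (h : mcHit T x k y π) :
    k ≤ 1 + (Finset.univ.filter (fun z : Fin n => (x : ℕ) < T ∧ (z : ℕ) < T ∧ mcReach T x z π)).card
    := by
  have : (Finset.Ico 1 k).card ≤ (Finset.univ.filter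
      (fun z : Fin n => (x : ℕ) < T ∧ (z : ℕ) < T ∧ mcReach T x z π)).card := by
    apply Finset.card_le_card_of_injOn (fun i => (π ^ i) x)
    · intro i hi
      simp only [Finset.coe_Ico, Set.mem_Ico] at hi
      simp only [Finset.coe_filter, Finset.mem_univ, true_and, Set.mem_ofPred_eq]
      refine ⟨by simpa using h.1 0 (by omega), h.1 i hi.2, i, hi.1, fun j hj => h.1 j (by omega), rfl⟩
    · have key : ∀ i j, i < j → j < k → (π ^ i) x = (π ^ j) x → False := by
        intro i j hij hjk e
        have a := mcHit_shift h i (by omega)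
        have b := mcHit_shift h j (by omega)
        rw [e] at a
        have := (mcHit_unique a b).1
        omega
      intro i hi j hj e
      simp only [Finset.coe_Ico, Set.mem_Ico] at hi hj
      rcases lt_trichotomy i j with hlt | heq | hlt
      · exact (key i j hlt hj.2 e).elim
      · exact heq
      · exact (key j i hlt hi.2 e.symm).elim
  simp only [Nat.card_Ico] at this
  omega

/-! ### The finite-`n` moment recursion -/

lemma mc_delta_nonneg (n : ℕ) (q : ℝ) (hq : 0 < q) (K : ℕ) : 0 ≤ mcDelta n q K := by
  unfold mcDelta; positivity

lemma mc_G_prob (n : ℕ) (q : ℝ) (hq : 0 < q) (hq1 : q ≤ 1) (K T : ℕ) (hK : 1 ≤ K)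
    (hT : T + K = n) (s t : Fin n) (hst : t ≠ s) (ht : (t : ℕ) < T) :
    mProb n q (fun π => ¬ mcG T s t π) ≤ 5 * mcDelta n q K := by
  have hd := mc_delta_nonneg n q hq K
  have hz : ∀ A : Equiv.Perm (Fin n) → Prop, mProb n q (fun π => False ∧ A π) = 0 := by
    intro A; simp [mProb]
  have r1 := mc_reach_prob n q hq hq1 K T hK hT.le t t ht ht
  have r2 : ∀ x y : Fin n, ((s : ℕ) < T → (x : ℕ) < T ∧ (y : ℕ) < T) →
      mProb n q (fun π => (s : ℕ) < T ∧ mcReach T x y π) ≤ mcDelta n q K := by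
    intro x y hxy
    by_cases hs : (s : ℕ) < T
    · refine le_trans (mc_prob_mono n q hq _ (mcReach T x y) (fun π h => h.2)) ?_
      exact mc_reach_prob n q hq hq1 K T hK hT.le x y (hxy hs).1 (hxy hs).2
    · simp only [hs]; rw [hz]; exact hd
  have r5 : mProb n q (fun π => T ≤ (s : ℕ) ∧ mcExit T t s π) ≤ mcDelta n q K := by
    by_cases hs : T ≤ (s : ℕ)
    · refine le_trans (mc_prob_mono n q hq _ (mcExit T t s) (fun π h => h.2)) ?_
      have := mc_single n q hq hq1 K T hT.le t s hs (by omega)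
      have hKr : (0 : ℝ) < K := by exact_mod_cast hK
      have c2 : 0 < q ^ (2 * K) * (K : ℝ) := by positivity
      have c4 : 0 ≤ (n : ℝ) / (q ^ (4 * K) * (K : ℝ) ^ 2) := by positivity
      have e : mProb n q (mcExit T t s) ≤ 1 / (q ^ (2 * K) * K) := by
        rw [le_div_iff₀ c2]; linarith
      have e2 : 1 / (q ^ (2 * K) * (K : ℝ)) ≤ 2 / (q ^ (2 * K) * K) := by
        gcongr; norm_num
      unfold mcDelta
      linarith
    · simp only [hs]; rw [hz]; exact hd
  have m := mc_prob_mono n q hq _ _ (fun π h => mc_bad (π := π) hst ht h)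
  have o1 := mc_prob_or n q hq (mcReach T t t) (fun π => ((s : ℕ) < T ∧ mcReach T s s π) ∨
    ((s : ℕ) < T ∧ mcReach T t s π) ∨
      ((s : ℕ) < T ∧ mcReach T s t π) ∨ (T ≤ (s : ℕ) ∧ mcExit T t s π))
  have o2 := mc_prob_or n q hq (fun π => (s : ℕ) < T ∧ mcReach T s s π) (fun π =>
    ((s : ℕ) < T ∧ mcReach T t s π) ∨
      ((s : ℕ) < T ∧ mcReach T s t π) ∨ (T ≤ (s : ℕ) ∧ mcExit T t s π))
  have o3 := mc_prob_or n q hq (fun π => (s : ℕ) < T ∧ mcReach T t s π) (fun π =>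
      ((s : ℕ) < T ∧ mcReach T s t π) ∨ (T ≤ (s : ℕ) ∧ mcExit T t s π))
  have o4 := mc_prob_or n q hq (fun π => (s : ℕ) < T ∧ mcReach T s t π) (fun π =>
      (T ≤ (s : ℕ) ∧ mcExit T t s π))
  have q2 := r2 s s (fun h => ⟨h, h⟩)
  have q3 := r2 t s (fun h => ⟨ht, h⟩)
  have q4 := r2 s t (fun h => ⟨h, ht⟩)
  linarith

/-- expected hitting time of the window -/
lemma mc_tau_exp (n : ℕ) (q : ℝ) (hq : 0 < q) (hq1 : q ≤ 1) (K T : ℕ) (hK : 1 ≤ K)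
    (hT : T + K = n) (x : Fin n) :
    ∑ π : Equiv.Perm (Fin n), mallowsP n q π *
      (if mcHit T x (mcTau T x π) (mcExt T x π) π then (mcTau T x π : ℝ) else 0)
      ≤ 1 + n * mcDelta n q K := by
  have hd := mc_delta_nonneg n q hq K
  have h1 : ∀ π : Equiv.Perm (Fin n), mallowsP n q π *
      (if mcHit T x (mcTau T x π) (mcExt T x π) π then (mcTau T x π : ℝ) else 0) ≤
      mallowsP n q π + ∑ z : Fin n,
        (if ((x : ℕ) < T ∧ (z : ℕ) < T ∧ mcReach T x z π) then mallowsP n q π else 0) := by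
    intro π
    have hp := mc_P_pos n q hq π
    rw [← Finset.sum_filter, Finset.sum_const, nsmul_eq_mul]
    split_ifs with h
    · have := mc_tau_le h
      have : (mcTau T x π : ℝ) ≤ 1 + ((Finset.univ.filter
        (fun z : Fin n => (x : ℕ) < T ∧ (z : ℕ) < T ∧ mcReach T x z π)).card : ℝ) := by
        exact_mod_cast this
      nlinarith
    · rw [mul_zero]; positivity
  refine le_trans (Finset.sum_le_sum (fun π _ => h1 π)) ?_
  rw [Finset.sum_add_distrib, mc_P_sum n q hq, Finset.sum_comm]
  have h2 : ∀ z : Fin n, ∑ π : Equiv.Perm (Fin n),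
      (if ((x : ℕ) < T ∧ (z : ℕ) < T ∧ mcReach T x z π) then mallowsP n q π else 0)
      ≤ mcDelta n q K := by
    intro z
    by_cases hx : (x : ℕ) < T ∧ (z : ℕ) < T
    · refine le_trans ?_ (mc_reach_prob n q hq hq1 K T hK hT.le x z hx.1 hx.2)
      refine le_trans (le_of_eq ?_) (mc_prob_mono n q hq
        (fun π => (x : ℕ) < T ∧ (z : ℕ) < T ∧ mcReach T x z π) _ (fun π h => h.2.2))
      unfold mProb
      apply Finset.sum_congr rfl
      intro π _
      congr
    · refine le_trans (le_of_eq ?_) hd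
      apply Finset.sum_eq_zero
      intro π _
      rw [if_neg]
      tauto
  have := Finset.sum_le_sum (fun z (_ : z ∈ (Finset.univ : Finset (Fin n))) => h2 z)
  simp only [Finset.sum_const, Finset.card_univ, Fintype.card_fin, nsmul_eq_mul] at this
  linarith

/-- summing over a cycle by distance to `s` -/
lemma mc_cycle_sum {n : ℕ} (π : Equiv.Perm (Fin n)) (s : Fin n) (h : ℕ → ℝ) :
    ∑ t ∈ Finset.univ.filter (fun t => π.SameCycle s t), h (mcDist t s π) =
      ∑ e ∈ Finset.range (Function.minimalPeriod π s), h e := by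
  set l := Function.minimalPeriod π s with hl
  have hper : (π ^ l) s = s := by
    rw [← mc_iter]; exact Function.iterate_minimalPeriod
  have hsame : ∀ e : ℕ, π.SameCycle s ((π ^ e)⁻¹ s) := by
    intro e
    exact (mc_sameCycle_nat.mpr ⟨e, by simp⟩ : π.SameCycle ((π ^ e)⁻¹ s) s).symm
  apply Finset.sum_nbij' (fun t => mcDist t s π) (fun e => (π ^ e)⁻¹ s)
  · intro t ht
    simp only [Finset.mem_filter, Finset.mem_univ, true_and] at ht
    obtain ⟨d1, d2⟩ := mcDist_spec ht
    simp only [Finset.mem_range]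
    by_contra hc
    push Not at hc
    have hlpos := mc_minPer_pos π s
    have : (π ^ (mcDist t s π - l)) t = s := by
      apply (π ^ l).injective
      rw [hper, ← Equiv.Perm.mul_apply, ← pow_add]
      conv_rhs => rw [← d1]
      congr 2; omega
    have := d2 _ this
    omega
  · intro e _
    simp only [Finset.mem_filter, Finset.mem_univ, true_and]
    exact hsame e
  · intro t ht
    simp only [Finset.mem_filter, Finset.mem_univ, true_and] at ht
    obtain ⟨d1, d2⟩ := mcDist_spec ht
    rw [Equiv.Perm.inv_eq_iff_eq, d1]
  · intro e he
    simp only [Finset.mem_range] at he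
    obtain ⟨d1, d2⟩ := mcDist_spec (hsame e)
    have hle := d2 e (by simp)
    by_contra hne
    have hpp : (π ^ (e - mcDist ((π ^ e)⁻¹ s) s π)) s = s := by
      have h1 : (π ^ e) ((π ^ e)⁻¹ s) = s := by simp
      conv_rhs => rw [← h1]
      conv_lhs => rw [← d1]
      rw [← Equiv.Perm.mul_apply, ← pow_add, d1]
      congr 2; omega
    have : Function.IsPeriodicPt π (e - mcDist ((π ^ e)⁻¹ s) s π) s := by
      unfold Function.IsPeriodicPt Function.IsFixedPt; rw [mc_iter]; exact hpp
    have := this.minimalPeriod_le (by omega)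
    omega
  · intro t _; rfl

lemma mc_cycle_card {n : ℕ} (π : Equiv.Perm (Fin n)) (s : Fin n) :
    (Finset.univ.filter (fun t => π.SameCycle s t)).card = Function.minimalPeriod π s := by
  have := mc_cycle_sum π s (fun _ => 1)
  simp only [Finset.sum_const, nsmul_eq_mul, mul_one, Finset.card_range] at this
  exact_mod_cast this

lemma mc_per_le {n : ℕ} (π : Equiv.Perm (Fin n)) (s : Fin n) : Function.minimalPeriod π s ≤ n := by
  rw [← mc_cycle_card]
  exact (Finset.card_le_univ _).trans (by simp)

lemma mc_dist_le {n : ℕ} (π : Equiv.Perm (Fin n)) (s t : Fin n) (h : π.SameCycle s t) :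
    mcDist t s π ≤ n := by
  by_contra hc
  have := mc_cycle_sum π s (fun k => if n < k then 1 else 0)
  rw [Finset.sum_eq_zero (s := Finset.range _)] at this
  · rw [Finset.sum_eq_zero_iff_of_nonneg (by intros; positivity)] at this
    have := this t (by simp [h])
    simp at this
    omega
  · intro e he
    rw [if_neg]
    have := mc_per_le π s
    simp at he
    omega

lemma mc_theta_P (n : ℕ) (q : ℝ) (hq : 0 < q) (hq1 : q ≤ 1) (K T : ℕ)
    (hT : T + K = n) (s t : Fin n) (π : Equiv.Perm (Fin n)) (h : mcG T s t π) :
    |mallowsP n q (mcTheta T s t π) - mallowsP n q π| ≤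
      (1 / q ^ (2 * K) - 1) * mallowsP n q π := by
  have a := h.1.2.2
  have b := h.2.1.2.2
  have h1 := mc_inv_swap' n K π (mcExt T s π) (mcExt T t π) (by omega) (by omega)
  have h2 := mc_inv_swap' n K (mcTheta T s t π) (mcExt T s π) (mcExt T t π) (by omega) (by omega)
  have e : mcTheta T s t π * Equiv.swap (mcExt T s π) (mcExt T t π) = π := by
    unfold mcTheta; rw [mul_assoc, Equiv.swap_mul_self, mul_one]
  rw [e] at h2
  have p1 := mc_P_le n q hq hq1 π (mcTheta T s t π) (2 * K) h1
  have p2 := mc_P_le n q hq hq1 (mcTheta T s t π) π (2 * K) h2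
  have hp := mc_P_pos n q hq π
  set P := mallowsP n q π
  set P' := mallowsP n q (mcTheta T s t π)
  have hx : 0 < q ^ (2 * K) := by positivity
  have hx1 : q ^ (2 * K) ≤ 1 := pow_le_one₀ hq.le hq1
  set x := q ^ (2 * K)
  have p3 : P' ≤ 1 / x * P := by
    rw [one_div_mul_eq_div, le_div_iff₀ hx]; linarith
  have p4 : 2 - x ≤ 1 / x := by
    rw [le_div_iff₀ hx]; nlinarith [sq_nonneg (x - 1)]
  rw [abs_le]
  constructor
  · nlinarith
  · linarith

lemma mc_switch_eq (n : ℕ) (q : ℝ) (T : ℕ) (s t : Fin n) (g : ℕ → ℝ) :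
    ∑ π ∈ Finset.univ.filter (fun π : Equiv.Perm (Fin n) => mcG T s t π ∧ ¬ π.SameCycle s t),
      mallowsP n q π * g (Function.minimalPeriod π s) =
    ∑ π ∈ Finset.univ.filter (fun π : Equiv.Perm (Fin n) => mcG T s t π ∧ π.SameCycle s t),
      mallowsP n q (mcTheta T s t π) * g (Function.minimalPeriod (mcTheta T s t π) s) := by
  apply Finset.sum_nbij' (fun π => mcTheta T s t π) (fun π => mcTheta T s t π)
  · intro π h
    simp only [Finset.mem_filter, Finset.mem_univ, true_and] at h ⊢
    exact ⟨(mcG_theta h.1).1, (mc_theta_same h.1).mpr h.2⟩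
  · intro π h
    simp only [Finset.mem_filter, Finset.mem_univ, true_and] at h ⊢
    exact ⟨(mcG_theta h.1).1, (mc_split_G h.1 h.2).2⟩
  · intro π h
    simp only [Finset.mem_filter, Finset.mem_univ, true_and] at h
    exact (mcG_theta h.1).2.2.2
  · intro π h
    simp only [Finset.mem_filter, Finset.mem_univ, true_and] at h
    exact (mcG_theta h.1).2.2.2
  · intro π h
    simp only [Finset.mem_filter, Finset.mem_univ, true_and] at h
    rw [(mcG_theta h.1).2.2.2]

lemma mc_switch (n : ℕ) (q : ℝ) (hq : 0 < q) (hq1 : q ≤ 1) (K T : ℕ) (hK : 1 ≤ K)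
    (hT : T + K = n) (s t : Fin n) (hst : t ≠ s) (ht : (t : ℕ) < T) (g : ℕ → ℝ) (L : ℝ)
    (hL : 0 ≤ L)
    (hg : ∀ m, m ≤ n → 0 ≤ g m ∧ g m ≤ 1)
    (hlip : ∀ a b, a ≤ n → b ≤ n → |g a - g b| ≤ L * |(a : ℝ) - b|) :
    |mExp n q (fun π => if π.SameCycle s t then 0 else g (Function.minimalPeriod π s)) -
      mExp n q (fun π => if π.SameCycle s t then g (mcDist t s π) else 0)| ≤
      5 * mcDelta n q K + (1 / q ^ (2 * K) - 1) + 2 * L * (1 + n * mcDelta n q K) := by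
  set δ := mcDelta n q K with hδ
  set C := 1 / q ^ (2 * K) - 1 with hC
  have hCn : 0 ≤ C := by
    have hx : 0 < q ^ (2 * K) := by positivity
    have hx1 : q ^ (2 * K) ≤ 1 := pow_le_one₀ hq.le hq1
    rw [hC, sub_nonneg, le_div_iff₀ hx]; linarith
  let G : Equiv.Perm (Fin n) → Prop := mcG T s t
  let S : Equiv.Perm (Fin n) → Prop := fun π => π.SameCycle s t
  -- decomposition
  have dec : mExp n q (fun π => if π.SameCycle s t then 0 else g (Function.minimalPeriod π s)) -
      mExp n q (fun π => if π.SameCycle s t then g (mcDist t s π) else 0) =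
      (∑ π : Equiv.Perm (Fin n), if G π ∧ S π then
        (mallowsP n q (mcTheta T s t π) * g (Function.minimalPeriod (mcTheta T s t π) s) -
        mallowsP n q π * g (mcDist t s π)) else 0) +
      ∑ π : Equiv.Perm (Fin n), if ¬ G π then mallowsP n q π *
        (if S π then - g (mcDist t s π) else g (Function.minimalPeriod π s)) else 0 := by
    have e1 := mc_switch_eq n q T s t g
    rw [Finset.sum_filter, Finset.sum_filter] at e1
    have e2 : (∑ π : Equiv.Perm (Fin n), if G π ∧ S π then
        (mallowsP n q (mcTheta T s t π) * g (Function.minimalPeriod (mcTheta T s t π) s) -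
        mallowsP n q π * g (mcDist t s π)) else 0) =
        (∑ π : Equiv.Perm (Fin n), if G π ∧ S π then
          (mallowsP n q (mcTheta T s t π) * g (Function.minimalPeriod (mcTheta T s t π) s)) else 0)
        - ∑ π : Equiv.Perm (Fin n), if G π ∧ S π then mallowsP n q π * g (mcDist t s π) else 0 := by
      rw [← Finset.sum_sub_distrib]
      apply Finset.sum_congr rfl
      intro π _
      split_ifs <;> simp
    rw [e2]
    have e3 : (∑ π : Equiv.Perm (Fin n), if G π ∧ S π then
          (mallowsP n q (mcTheta T s t π) * g (Function.minimalPeriod (mcTheta T s t π) s)) else 0)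
        = ∑ π : Equiv.Perm (Fin n), if G π ∧ ¬ S π then
          mallowsP n q π * g (Function.minimalPeriod π s) else 0 := e1.symm
    rw [e3]
    unfold mExp
    rw [← Finset.sum_sub_distrib, ← Finset.sum_sub_distrib, ← Finset.sum_add_distrib]
    apply Finset.sum_congr rfl
    intro π _
    by_cases h1 : G π <;> by_cases h2 : S π
    · have h2' : π.SameCycle s t := h2
      simp [h1, h2, h2']
    · have h2' : ¬ π.SameCycle s t := h2
      simp [h1, h2, h2']
    · have h2' : π.SameCycle s t := h2
      simp [h1, h2, h2']
    · have h2' : ¬ π.SameCycle s t := h2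
      simp [h1, h2, h2']
  rw [dec]
  have b2 : |∑ π : Equiv.Perm (Fin n), if ¬ G π then mallowsP n q π *
        (if S π then - g (mcDist t s π) else g (Function.minimalPeriod π s)) else 0| ≤ 5 * δ := by
    refine le_trans ?_ (mc_G_prob n q hq hq1 K T hK hT s t hst ht)
    refine le_trans (Finset.abs_sum_le_sum_abs _ _) ?_
    unfold mProb
    apply Finset.sum_le_sum
    intro π _
    have hp := mc_P_pos n q hq π
    by_cases h1 : G π
    · have h1' : mcG T s t π := h1
      simp [h1, h1']
    · have h1' : ¬ mcG T s t π := h1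
      rw [if_pos h1, if_pos h1', abs_mul, abs_of_pos hp]
      have : |if S π then - g (mcDist t s π) else g (Function.minimalPeriod π s)| ≤ 1 := by
        split_ifs with h2
        · have := hg _ (mc_dist_le π s t h2)
          rw [abs_neg, abs_le]; constructor <;> linarith
        · have := hg _ (mc_per_le π s)
          rw [abs_le]; constructor <;> linarith
      nlinarith
  have b1 : |∑ π : Equiv.Perm (Fin n), if G π ∧ S π then
        (mallowsP n q (mcTheta T s t π) * g (Function.minimalPeriod (mcTheta T s t π) s) -
        mallowsP n q π * g (mcDist t s π)) else 0| ≤ C + 2 * L * (1 + n * δ) := by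
    have hpt : ∀ π : Equiv.Perm (Fin n), |if G π ∧ S π then
        (mallowsP n q (mcTheta T s t π) * g (Function.minimalPeriod (mcTheta T s t π) s) -
        mallowsP n q π * g (mcDist t s π)) else 0| ≤ mallowsP n q π * C + (L * (mallowsP n q π *
      (if mcHit T s (mcTau T s π) (mcExt T s π) π then (mcTau T s π : ℝ) else 0)) +
      L * (mallowsP n q π *
      (if mcHit T t (mcTau T t π) (mcExt T t π) π then (mcTau T t π : ℝ) else 0))) := by
      intro π
      have hp := mc_P_pos n q hq π
      by_cases h : G π ∧ S π
      · have hG : mcG T s t π := h.1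
        have hS : π.SameCycle s t := h.2
        rw [if_pos h, if_pos hG.1, if_pos hG.2.1]
        have c1 := mc_theta_P n q hq hq1 K T hT s t π hG
        have c2 := (mc_split_G hG hS).1
        have c3 := hg _ (mc_per_le (mcTheta T s t π) s)
        have c4 := hlip _ _ (mc_per_le (mcTheta T s t π) s) (mc_dist_le π s t hS)
        set a := Function.minimalPeriod (mcTheta T s t π) s
        set b := mcDist t s π
        have c5 : |(a : ℝ) - b| ≤ mcTau T s π + mcTau T t π := by
          have : (a : ℝ) + mcTau T t π = b + mcTau T s π := by exact_mod_cast c2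
          have n1 : (0 : ℝ) ≤ mcTau T s π := by positivity
          have n2 : (0 : ℝ) ≤ mcTau T t π := by positivity
          rw [abs_le]; constructor <;> linarith
        have c6 : |g a - g b| ≤ L * (mcTau T s π + mcTau T t π) :=
          c4.trans (mul_le_mul_of_nonneg_left c5 hL)
        have c7 : mallowsP n q (mcTheta T s t π) * g a - mallowsP n q π * g b =
          (mallowsP n q (mcTheta T s t π) - mallowsP n q π) * g a +
            mallowsP n q π * (g a - g b) := by ring
        rw [c7]
        refine (abs_add_le _ _).trans ?_
        rw [abs_mul, abs_mul, abs_of_pos hp, abs_of_nonneg c3.1]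
        have c8 : |mallowsP n q (mcTheta T s t π) - mallowsP n q π| * g a ≤ mallowsP n q π * C := by
          calc _ ≤ |mallowsP n q (mcTheta T s t π) - mallowsP n q π| * 1 :=
                mul_le_mul_of_nonneg_left c3.2 (abs_nonneg _)
            _ ≤ _ := by rw [mul_one, mul_comm]; exact c1
        have c9 := mul_le_mul_of_nonneg_left c6 hp.le
        linarith
      · rw [if_neg h, abs_zero]
        have : (0 : ℝ) ≤ if mcHit T s (mcTau T s π) (mcExt T s π) π then (mcTau T s π : ℝ) else 0 := by
          split_ifs <;> positivity
        have : (0 : ℝ) ≤ if mcHit T t (mcTau T t π) (mcExt T t π) π then (mcTau T t π : ℝ) else 0 := by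
          split_ifs <;> positivity
        positivity
    refine le_trans (Finset.abs_sum_le_sum_abs _ _) ?_
    refine le_trans (Finset.sum_le_sum (fun π _ => hpt π)) ?_
    rw [Finset.sum_add_distrib, Finset.sum_add_distrib, ← Finset.sum_mul, mc_P_sum n q hq,
      ← Finset.mul_sum, ← Finset.mul_sum]
    have t1 := mul_le_mul_of_nonneg_left (mc_tau_exp n q hq hq1 K T hK hT s) hL
    have t2 := mul_le_mul_of_nonneg_left (mc_tau_exp n q hq hq1 K T hK hT t) hL
    linarith
  have := abs_add_le (∑ π : Equiv.Perm (Fin n), if G π ∧ S π then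
        (mallowsP n q (mcTheta T s t π) * g (Function.minimalPeriod (mcTheta T s t π) s) -
        mallowsP n q π * g (mcDist t s π)) else 0)
      (∑ π : Equiv.Perm (Fin n), if ¬ G π then mallowsP n q π *
        (if S π then - g (mcDist t s π) else g (Function.minimalPeriod π s)) else 0)
  linarith

lemma mc_exp_unit (n : ℕ) (q : ℝ) (hq : 0 < q) (X : Equiv.Perm (Fin n) → ℝ)
    (h : ∀ π, 0 ≤ X π ∧ X π ≤ 1) : 0 ≤ mExp n q X ∧ mExp n q X ≤ 1 := by
  unfold mExp
  constructor
  · exact Finset.sum_nonneg (fun π _ => mul_nonneg (mc_P_pos n q hq π).le (h π).1)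
  · rw [← mc_P_sum n q hq]
    apply Finset.sum_le_sum
    intro π _
    have := mc_P_pos n q hq π
    have := h π
    nlinarith

lemma mc_switch_sum (n : ℕ) (q : ℝ) (hq : 0 < q) (hq1 : q ≤ 1) (K : ℕ) (hK : 1 ≤ K)
    (hKn : K ≤ n) (s : Fin n) (g : ℕ → ℝ) (L : ℝ) (hL : 0 ≤ L)
    (hg : ∀ m, m ≤ n → 0 ≤ g m ∧ g m ≤ 1)
    (hlip : ∀ a b, a ≤ n → b ≤ n → |g a - g b| ≤ L * |(a : ℝ) - b|) :
    |mExp n q (fun π => ((n : ℝ) - Function.minimalPeriod π s) * g (Function.minimalPeriod π s)) -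
      mExp n q (fun π => ∑ e ∈ Finset.range (Function.minimalPeriod π s), g e)| ≤
      n * (5 * mcDelta n q K + (1 / q ^ (2 * K) - 1) + 2 * L * (1 + n * mcDelta n q K))
        + (K + 1) := by
  set E := 5 * mcDelta n q K + (1 / q ^ (2 * K) - 1) + 2 * L * (1 + n * mcDelta n q K) with hE
  have hEn : 0 ≤ E := by
    have hx : 0 < q ^ (2 * K) := by positivity
    have hx1 : q ^ (2 * K) ≤ 1 := pow_le_one₀ hq.le hq1
    have : 1 ≤ 1 / q ^ (2 * K) := by rw [le_div_iff₀ hx]; linarith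
    have hd := mc_delta_nonneg n q hq K
    have : 0 ≤ 2 * L * (1 + n * mcDelta n q K) := by positivity
    linarith
  clear_value E
  have a1 : mExp n q (fun π => ((n : ℝ) - Function.minimalPeriod π s) *
      g (Function.minimalPeriod π s)) = ∑ t : Fin n, mExp n q
        (fun π => if π.SameCycle s t then 0 else g (Function.minimalPeriod π s)) := by
    unfold mExp
    rw [Finset.sum_comm]
    apply Finset.sum_congr rfl
    intro π _
    rw [← Finset.mul_sum]
    congr 1
    have c := mc_cycle_card π s
    have h1 : ∑ t : Fin n, (if π.SameCycle s t then g (Function.minimalPeriod π s) else 0) =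
        (Function.minimalPeriod π s : ℝ) * g (Function.minimalPeriod π s) := by
      rw [← Finset.sum_filter, Finset.sum_const, nsmul_eq_mul, c]
    have h2 : ∑ t : Fin n, (if π.SameCycle s t then 0 else g (Function.minimalPeriod π s)) +
        ∑ t : Fin n, (if π.SameCycle s t then g (Function.minimalPeriod π s) else 0) =
        (n : ℝ) * g (Function.minimalPeriod π s) := by
      rw [← Finset.sum_add_distrib]
      have : ∀ t : Fin n, (if π.SameCycle s t then 0 else g (Function.minimalPeriod π s)) +
        (if π.SameCycle s t then g (Function.minimalPeriod π s) else 0) =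
          g (Function.minimalPeriod π s) := by intro t; split_ifs <;> simp
      simp [this]
    linarith
  have a2 : mExp n q (fun π => ∑ e ∈ Finset.range (Function.minimalPeriod π s), g e) =
      ∑ t : Fin n, mExp n q (fun π => if π.SameCycle s t then g (mcDist t s π) else 0) := by
    unfold mExp
    rw [Finset.sum_comm]
    apply Finset.sum_congr rfl
    intro π _
    rw [← Finset.mul_sum]
    congr 1
    show ∑ e ∈ Finset.range (Function.minimalPeriod π s), g e = _
    rw [← mc_cycle_sum, Finset.sum_filter]
  rw [a1, a2, ← Finset.sum_sub_distrib]
  refine (Finset.abs_sum_le_sum_abs _ _).trans ?_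
  have hpt : ∀ t : Fin n, |mExp n q
        (fun π => if π.SameCycle s t then 0 else g (Function.minimalPeriod π s)) -
      mExp n q (fun π => if π.SameCycle s t then g (mcDist t s π) else 0)| ≤
      E + ((if t = s then 1 else 0) + (if n - K ≤ (t : ℕ) then 1 else 0)) := by
    intro t
    by_cases h : t ≠ s ∧ (t : ℕ) < n - K
    · have := mc_switch n q hq hq1 K (n - K) hK (by omega) s t h.1 h.2 g L hL hg hlip
      rw [if_neg h.1, if_neg (by omega)]
      linarith
    · have u1 := mc_exp_unit n q hq
        (fun π => if π.SameCycle s t then 0 else g (Function.minimalPeriod π s)) (by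
          intro π
          have := hg _ (mc_per_le π s)
          split_ifs
          · simp
          · exact this)
      have u2 := mc_exp_unit n q hq
        (fun π => if π.SameCycle s t then g (mcDist t s π) else 0) (by
          intro π
          split_ifs with h
          · exact hg _ (mc_dist_le π s t h)
          · simp)
      have u3 : (1 : ℝ) ≤ (if t = s then 1 else 0) + (if n - K ≤ (t : ℕ) then 1 else 0) := by
        by_cases h1 : t = s
        · rw [if_pos h1]; split_ifs <;> norm_num
        · have : n - K ≤ (t : ℕ) := by
            by_contra hc; exact h ⟨h1, by omega⟩
          rw [if_neg h1, if_pos this]; norm_num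
      rw [abs_le]; constructor <;> linarith [u1.1, u1.2, u2.1, u2.2]
  refine (Finset.sum_le_sum (fun t _ => hpt t)).trans ?_
  rw [Finset.sum_add_distrib, Finset.sum_add_distrib]
  have s1 : ∑ t : Fin n, (if t = s then (1 : ℝ) else 0) = 1 := by simp
  have s2 : ∑ t : Fin n, (if n - K ≤ (t : ℕ) then (1 : ℝ) else 0) ≤ K := by
    rw [← Finset.sum_filter, Finset.sum_const, nsmul_eq_mul, mul_one]
    have : (Finset.univ.filter (fun t : Fin n => n - K ≤ (t : ℕ))).card ≤
        (Finset.Ico (n - K) n).card := by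
      apply Finset.card_le_card_of_injOn (fun t : Fin n => (t : ℕ))
      · intro t ht
        simp at ht ⊢
        exact ht
      · intro a _ b _ h
        exact Fin.ext h
    rw [Nat.card_Ico] at this
    exact_mod_cast (by omega : _ ≤ K)
  rw [s1]
  simp only [Finset.sum_const, Finset.card_univ, Fintype.card_fin, nsmul_eq_mul]
  linarith

/-! ### Moments and the limit -/

lemma mc_pow_lip (j : ℕ) (x y : ℝ) (hx : 0 ≤ x) (hx1 : x ≤ 1) (hy : 0 ≤ y) (hy1 : y ≤ 1) :
    |x ^ j - y ^ j| ≤ j * |x - y| := by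
  induction j with
  | zero => simp
  | succ j ih =>
    have e : x ^ (j + 1) - y ^ (j + 1) = x * (x ^ j - y ^ j) + (x - y) * y ^ j := by ring
    rw [e]
    refine (abs_add_le _ _).trans ?_
    rw [abs_mul, abs_mul, abs_of_nonneg hx, abs_of_nonneg (pow_nonneg hy j)]
    have h1 : x * |x ^ j - y ^ j| ≤ |x ^ j - y ^ j| := mul_le_of_le_one_left (abs_nonneg _) hx1
    have h2 : |x - y| * y ^ j ≤ |x - y| :=
      mul_le_of_le_one_right (abs_nonneg _) (pow_le_one₀ hy hy1)
    push_cast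
    linarith

lemma mc_step_low (j : ℕ) (x : ℝ) (hx : 0 ≤ x) :
    x ^ (j + 1) + (j + 1) * x ^ j ≤ (x + 1) ^ (j + 1) := by
  induction j with
  | zero => simp
  | succ j ih =>
    have h := mul_le_mul_of_nonneg_left ih (by linarith : (0 : ℝ) ≤ x + 1)
    have hp : 0 ≤ (j + 1 : ℝ) * x ^ j := by positivity
    calc x ^ (j + 1 + 1) + (((j + 1 : ℕ) : ℝ) + 1) * x ^ (j + 1)
        ≤ (x + 1) * (x ^ (j + 1) + (j + 1) * x ^ j) := by
          push_cast
          have : (x + 1) * (x ^ (j + 1) + (j + 1) * x ^ j) = x ^ (j + 1 + 1) + (j + 1 + 1) * x ^ (j + 1)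
            + (j + 1) * x ^ j := by ring
          linarith
      _ ≤ _ := h
      _ = _ := by ring

lemma mc_step_up (j : ℕ) (x : ℝ) (hx : 0 ≤ x) :
    (x + 1) ^ (j + 1) ≤ x ^ (j + 1) + (j + 1) * (x + 1) ^ j := by
  induction j with
  | zero => simp
  | succ j ih =>
    have h := mul_le_mul_of_nonneg_left ih hx
    have hp : 0 ≤ (j + 1 : ℝ) * (x + 1) ^ j := by positivity
    have e : (x + 1) ^ (j + 1 + 1) = x * (x + 1) ^ (j + 1) + (x + 1) ^ (j + 1) := by ring
    have e2 : x * (x ^ (j + 1) + (j + 1) * (x + 1) ^ j) =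
      x ^ (j + 1 + 1) + (j + 1) * (x + 1) ^ (j + 1) - (j + 1) * (x + 1) ^ j := by ring
    push_cast
    linarith

lemma mc_sum_pow (j l : ℕ) :
    (∑ e ∈ Finset.range l, (e : ℝ) ^ j) ≤ (l : ℝ) ^ (j + 1) / (j + 1) ∧
    (l : ℝ) ^ (j + 1) / (j + 1) ≤ (∑ e ∈ Finset.range l, (e : ℝ) ^ j) + (l : ℝ) ^ j := by
  have hj : (0 : ℝ) < j + 1 := by positivity
  constructor
  · rw [le_div_iff₀ hj]
    induction l with
    | zero => simp
    | succ l ih =>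
      rw [Finset.sum_range_succ]
      have := mc_step_low j l (by positivity)
      push_cast
      linarith
  · rw [div_le_iff₀ hj]
    have key : (l : ℝ) ^ (j + 1) ≤ (∑ e ∈ Finset.range l, ((e : ℝ) + 1) ^ j) * (j + 1) := by
      induction l with
      | zero => simp
      | succ l ih =>
        rw [Finset.sum_range_succ]
        have := mc_step_up j l (by positivity)
        push_cast
        linarith
    have h2 : ∑ e ∈ Finset.range l, ((e : ℝ) + 1) ^ j ≤
        (∑ e ∈ Finset.range l, (e : ℝ) ^ j) + (l : ℝ) ^ j := by
      have a := Finset.sum_range_succ (fun e : ℕ => (e : ℝ) ^ j) l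
      have b := Finset.sum_range_succ' (fun e : ℕ => (e : ℝ) ^ j) l
      push_cast at b
      have : (0 : ℝ) ≤ (0 : ℝ) ^ j := by positivity
      linarith
    exact key.trans (mul_le_mul_of_nonneg_right h2 hj.le)

lemma mc_exp_sub_le (n : ℕ) (q : ℝ) (hq : 0 < q) (X Y : Equiv.Perm (Fin n) → ℝ) (c : ℝ)
    (h : ∀ π, |X π - Y π| ≤ c) : |mExp n q X - mExp n q Y| ≤ c := by
  unfold mExp
  rw [← Finset.sum_sub_distrib]
  refine (Finset.abs_sum_le_sum_abs _ _).trans ?_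
  have : c = ∑ π : Equiv.Perm (Fin n), mallowsP n q π * c := by
    rw [← Finset.sum_mul, mc_P_sum n q hq, one_mul]
  rw [this]
  apply Finset.sum_le_sum
  intro π _
  have hp := mc_P_pos n q hq π
  rw [← mul_sub, abs_mul, abs_of_pos hp]
  exact mul_le_mul_of_nonneg_left (h π) hp.le

lemma mc_recursion (n : ℕ) (q : ℝ) (hq : 0 < q) (hq1 : q ≤ 1) (K : ℕ) (hK : 1 ≤ K)
    (hKn : K ≤ n) (s : Fin n) (j : ℕ) :
    |mExp n q (fun π => ((Function.minimalPeriod π s : ℝ) / n) ^ j) -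
      (j + 2) / (j + 1) * mExp n q (fun π => ((Function.minimalPeriod π s : ℝ) / n) ^ (j + 1))| ≤
      5 * mcDelta n q K + (1 / q ^ (2 * K) - 1) + 2 * j * (1 / n + mcDelta n q K)
        + (K + 2) / n := by
  have hn : (0 : ℝ) < n := by exact_mod_cast (by omega : 0 < n)
  have main := mc_switch_sum n q hq hq1 K hK hKn s (fun m => ((m : ℝ) / n) ^ j) (j / n)
    (by positivity) (by
      intro m hm
      have hm' : (m : ℝ) ≤ n := by exact_mod_cast hm
      have h1 : (m : ℝ) / n ≤ 1 := by rw [div_le_one hn]; exact hm'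
      exact ⟨by positivity, pow_le_one₀ (by positivity) h1⟩) (by
      intro a b ha hb
      have ha' : (a : ℝ) ≤ n := by exact_mod_cast ha
      have hb' : (b : ℝ) ≤ n := by exact_mod_cast hb
      have := mc_pow_lip j ((a : ℝ) / n) ((b : ℝ) / n) (by positivity)
        (by rw [div_le_one hn]; exact ha') (by positivity) (by rw [div_le_one hn]; exact hb')
      refine this.trans (le_of_eq ?_)
      rw [← sub_div, abs_div, abs_of_pos hn]
      ring)
  set m0 := mExp n q (fun π => ((Function.minimalPeriod π s : ℝ) / n) ^ j) with hm0
  set m1 := mExp n q (fun π => ((Function.minimalPeriod π s : ℝ) / n) ^ (j + 1)) with hm1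
  have e1 : mExp n q (fun π => ((n : ℝ) - Function.minimalPeriod π s) *
      ((Function.minimalPeriod π s : ℝ) / n) ^ j) = n * (m0 - m1) := by
    rw [hm0, hm1]
    unfold mExp
    rw [← Finset.sum_sub_distrib, Finset.mul_sum]
    apply Finset.sum_congr rfl
    intro π _
    have hy : (Function.minimalPeriod π s : ℝ) = n * ((Function.minimalPeriod π s : ℝ) / n) := by
      field_simp
    beta_reduce
    set y : ℝ := (Function.minimalPeriod π s : ℝ) / n
    rw [hy]
    ring
  have e2 : |mExp n q (fun π => ∑ e ∈ Finset.range (Function.minimalPeriod π s), ((e : ℝ) / n) ^ j) -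
      mExp n q (fun π => n / (j + 1) * ((Function.minimalPeriod π s : ℝ) / n) ^ (j + 1))| ≤ 1 := by
    apply mc_exp_sub_le n q hq
    intro π
    obtain ⟨h1, h2⟩ := mc_sum_pow j (Function.minimalPeriod π s)
    have hl : (Function.minimalPeriod π s : ℝ) ≤ n := by exact_mod_cast mc_per_le π s
    set l : ℝ := (Function.minimalPeriod π s : ℝ)
    have hl0 : 0 ≤ l := by positivity
    simp only [div_pow]
    rw [← Finset.sum_div]
    set S := ∑ e ∈ Finset.range (Function.minimalPeriod π s), (e : ℝ) ^ j
    have hnj : (0 : ℝ) < (n : ℝ) ^ j := by positivity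
    have hlj : l ^ j ≤ (n : ℝ) ^ j := pow_le_pow_left₀ hl0 hl j
    have e3 : S / (n : ℝ) ^ j - n / (j + 1) * (l ^ (j + 1) / (n : ℝ) ^ (j + 1)) =
        (S - l ^ (j + 1) / (j + 1)) / (n : ℝ) ^ j := by
      field_simp
      ring
    rw [e3, abs_div, abs_of_pos hnj, div_le_one hnj, abs_le]
    constructor <;> linarith
  have e4 : mExp n q (fun π => n / (j + 1) * ((Function.minimalPeriod π s : ℝ) / n) ^ (j + 1)) =
      n / (j + 1) * m1 := by
    rw [hm1]
    unfold mExp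
    rw [Finset.mul_sum]
    apply Finset.sum_congr rfl
    intro π _
    ring
  rw [e4] at e2
  rw [e1] at main
  set Q := mExp n q (fun π => ∑ e ∈ Finset.range (Function.minimalPeriod π s), ((e : ℝ) / n) ^ j)
  have hj : (0 : ℝ) < j + 1 := by positivity
  have e5 : (n : ℝ) * (m0 - (j + 2) / (j + 1) * m1) =
      (n * (m0 - m1) - Q) + (Q - n / (j + 1) * m1) := by
    field_simp
    ring
  have e6 : (n : ℝ) * |m0 - (j + 2) / (j + 1) * m1| ≤ n * (5 * mcDelta n q K + (1 / q ^ (2 * K) - 1)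
      + 2 * (j / n) * (1 + n * mcDelta n q K)) + (K + 1) + 1 := by
    have : (n : ℝ) * |m0 - (j + 2) / (j + 1) * m1| = |(n : ℝ) * (m0 - (j + 2) / (j + 1) * m1)| := by
      rw [abs_mul, abs_of_pos hn]
    rw [this, e5]
    refine (abs_add_le _ _).trans ?_
    linarith
  have e7 : n * (5 * mcDelta n q K + (1 / q ^ (2 * K) - 1)
      + 2 * (j / n) * (1 + n * mcDelta n q K)) + (K + 1) + 1 =
      (n : ℝ) * (5 * mcDelta n q K + (1 / q ^ (2 * K) - 1) + 2 * j * (1 / n + mcDelta n q K)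
        + (K + 2) / n) := by
    have e8 : (j / n : ℝ) * (1 + n * mcDelta n q K) = j * (1 / n + mcDelta n q K) := by
      field_simp
    have e9 : (n : ℝ) * ((K + 2) / n) = K + 2 := by field_simp
    rw [mul_assoc 2, e8, mul_add (n : ℝ) _ ((K + 2) / n : ℝ), e9]
    ring
  rw [e7] at e6
  exact le_of_mul_le_mul_left e6 hn

lemma mc_choice (q : ℕ → ℝ) (hq : ∀ n, 0 < q n ∧ q n < 1)
    (hlim : Filter.Tendsto (fun n : ℕ => (1 - q n) ^ 2 * (n : ℝ)) Filter.atTop (nhds 0))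
    (ε : ℝ) (hε : 0 < ε) :
    ∀ᶠ n : ℕ in Filter.atTop, ∃ K : ℕ, 1 ≤ K ∧ K ≤ n ∧ mcDelta n (q n) K ≤ ε ∧
      1 / (q n) ^ (2 * K) - 1 ≤ ε ∧ ((K : ℝ) + 2) / n ≤ ε ∧ 1 / (n : ℝ) ≤ ε := by
  set A : ℝ := max 1 (4 / ε) with hA
  have hA1 : 1 ≤ A := le_max_left _ _
  have hA2 : 4 / ε ≤ A := le_max_right _ _
  have hA2' : 4 ≤ A * ε := by rwa [div_le_iff₀ hε] at hA2
  have hs : Filter.Tendsto (fun n : ℕ => √(n : ℝ)) Filter.atTop Filter.atTop :=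
    Real.tendsto_sqrt_atTop.comp tendsto_natCast_atTop_atTop
  have hr : Filter.Tendsto (fun n : ℕ => (1 - q n) * √(n : ℝ)) Filter.atTop (nhds 0) := by
    have h1 := (Real.continuous_sqrt.tendsto 0).comp hlim
    rw [Real.sqrt_zero] at h1
    refine h1.congr ?_
    intro n
    have := hq n
    simp only [Function.comp_apply]
    rw [Real.sqrt_mul (sq_nonneg _), Real.sqrt_sq (by linarith)]
  set η := min (1 / 2) ε with hη
  have hη0 : 0 < η := lt_min (by norm_num) hε
  have ev1 := hr.eventually (gt_mem_nhds (show (0 : ℝ) < η / (8 * A) by positivity))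
  have ev2 := hs.eventually_ge_atTop 1
  have ev3 := hs.eventually_ge_atTop (8 / ε)
  have ev4 := hs.eventually_ge_atTop (4 * A / ε)
  have ev5 := hs.eventually_ge_atTop (2 * A)
  filter_upwards [ev1, ev2, ev3, ev4, ev5] with n h1 h2 h3 h4 h5
  obtain ⟨hq0, hq1⟩ := hq n
  set r := √(n : ℝ) with hrdef
  have hrr : r * r = n := Real.mul_self_sqrt (by positivity)
  have hn : (0 : ℝ) < n := by rw [← hrr]; nlinarith
  have hr0 : 0 < r := by linarith
  set K := ⌈A * r⌉₊ with hKdef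
  have k1 : A * r ≤ K := Nat.le_ceil _
  have k2 : (K : ℝ) < A * r + 1 := Nat.ceil_lt_add_one (by positivity)
  have hAr : 1 ≤ A * r := by nlinarith
  have k3 : (K : ℝ) ≤ 2 * A * r := by linarith
  have hK1 : (1 : ℝ) ≤ K := by linarith
  have hKn : (K : ℝ) ≤ n := by rw [← hrr]; nlinarith
  have hd : 4 * K * (1 - q n) ≤ η := by
    rw [lt_div_iff₀ (by positivity)] at h1
    have : 4 * K * (1 - q n) ≤ 4 * (2 * A * r) * (1 - q n) := by
      apply mul_le_mul_of_nonneg_right _ (by linarith)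
      linarith
    linarith
  have hη1 : η ≤ 1 / 2 := min_le_left _ _
  have hη2 : η ≤ ε := min_le_right _ _
  have bern : ∀ m : ℕ, 1 - m * (1 - q n) ≤ q n ^ m := by
    intro m
    have := one_add_mul_le_pow (show (-2 : ℝ) ≤ q n - 1 by linarith) m
    have e : 1 + (q n - 1) = q n := by ring
    rw [e] at this
    linarith
  have b2 := bern (2 * K)
  have b4 := bern (4 * K)
  push_cast at b2 b4
  have x2 : 1 - η / 2 ≤ q n ^ (2 * K) := by linarith
  have x4 : 1 / 2 ≤ q n ^ (4 * K) := by linarith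
  have x2' : 1 / 2 ≤ q n ^ (2 * K) := by linarith
  refine ⟨K, by exact_mod_cast hK1, by exact_mod_cast hKn, ?_, ?_, ?_, ?_⟩
  · unfold mcDelta
    have d1 : 2 / (q n ^ (2 * K) * K) ≤ ε / 2 := by
      rw [div_le_iff₀ (by positivity)]
      rw [div_le_iff₀ hε] at h3
      have : 1 / 2 * r ≤ q n ^ (2 * K) * K := by
        apply mul_le_mul x2' _ hr0.le (by positivity)
        have := mul_le_mul_of_nonneg_right hA1 hr0.le
        linarith
      have := mul_le_mul_of_nonneg_left this (by positivity : 0 ≤ ε / 2)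
      linarith
    have d2 : n / (q n ^ (4 * K) * (K : ℝ) ^ 2) ≤ ε / 2 := by
      rw [div_le_iff₀ (by positivity)]
      have : 1 / 2 * (A * (r * r)) ≤ q n ^ (4 * K) * (K : ℝ) ^ 2 := by
        apply mul_le_mul x4 _ (by positivity) (by positivity)
        calc A * (r * r) ≤ (A * r) ^ 2 := by nlinarith [mul_self_nonneg r]
          _ ≤ _ := pow_le_pow_left₀ (by positivity) k1 2
      rw [hrr] at this
      have : ε / 2 * (1 / 2 * (A * n)) ≤ ε / 2 * (q n ^ (4 * K) * (K : ℝ) ^ 2) :=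
        mul_le_mul_of_nonneg_left this (by positivity)
      have := mul_le_mul_of_nonneg_right hA2' hn.le
      linarith
    linarith
  · have hx : 0 < q n ^ (2 * K) := by positivity
    rw [sub_le_iff_le_add, div_le_iff₀ hx]
    have := mul_le_mul_of_nonneg_left x2' hε.le
    linarith
  · rw [div_le_iff₀ hn, ← hrr]
    rw [div_le_iff₀ hε] at h4
    have := mul_le_mul_of_nonneg_right h4 hr0.le
    linarith
  · rw [div_le_iff₀ hn, ← hrr]
    rw [div_le_iff₀ hε] at h3
    have := mul_le_mul_of_nonneg_right h3 hr0.le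
    linarith

lemma mc_card_eq (n : ℕ) (π : Equiv.Perm (Fin n)) (k : ℕ) (s : Fin n) (h : (s : ℕ) + 1 = k) :
    cycleCardNat n π k = Function.minimalPeriod π s := by
  rw [← mc_cycle_card]
  unfold cycleCardNat
  congr 1
  ext t
  simp only [Finset.mem_filter, Finset.mem_univ, true_and]
  constructor
  · rintro ⟨u, hu, hc⟩
    have : u = s := Fin.ext (by omega)
    rwa [this] at hc
  · intro hc
    exact ⟨s, h, hc⟩

lemma mc_moment (q : ℕ → ℝ) (s : ℕ → ℕ) (hq : ∀ n, 0 < q n ∧ q n < 1)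
    (hlim : Filter.Tendsto (fun n : ℕ => (1 - q n) ^ 2 * (n : ℝ)) Filter.atTop (nhds 0))
    (hs : ∀ n : ℕ, 1 ≤ n → 1 ≤ s n ∧ s n ≤ n) (j : ℕ) :
    Filter.Tendsto (fun n : ℕ => mExp n (q n) (fun π => ((cycleCardNat n π (s n) : ℝ) / n) ^ j))
      Filter.atTop (nhds (1 / (j + 1))) := by
  induction j with
  | zero =>
    have : ∀ n : ℕ, mExp n (q n) (fun π => ((cycleCardNat n π (s n) : ℝ) / n) ^ 0) = 1 := by
      intro n
      simp only [mExp, pow_zero, mul_one]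
      exact mc_P_sum n (q n) (hq n).1
    simp only [this]
    simp
  | succ j ih =>
    have hdiff : Filter.Tendsto (fun n : ℕ =>
        mExp n (q n) (fun π => ((cycleCardNat n π (s n) : ℝ) / n) ^ j) -
        (j + 2) / (j + 1) * mExp n (q n) (fun π => ((cycleCardNat n π (s n) : ℝ) / n) ^ (j + 1)))
        Filter.atTop (nhds 0) := by
      rw [Metric.tendsto_atTop']
      intro ε hε
      have hc : (0 : ℝ) < 4 * j + 8 := by positivity
      obtain ⟨N, hN⟩ := Filter.eventually_atTop.mp
        (mc_choice q hq hlim (ε / (4 * j + 8)) (by positivity))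
      refine ⟨N, fun n hn => ?_⟩
      obtain ⟨K, k1, k2, k3, k4, k5, k6⟩ := hN n hn.le
      have hsn := hs n (by omega)
      have e : ∀ π : Equiv.Perm (Fin n), cycleCardNat n π (s n) =
          Function.minimalPeriod π (⟨s n - 1, by omega⟩ : Fin n) := fun π =>
        mc_card_eq n π (s n) ⟨s n - 1, by omega⟩ (by simp; omega)
      simp only [e]
      rw [Real.dist_eq, sub_zero]
      have := mc_recursion n (q n) (hq n).1 (hq n).2.le K k1 k2 ⟨s n - 1, by omega⟩ j
      refine lt_of_le_of_lt this ?_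
      set η := ε / (4 * j + 8) with hη
      have hη' : η * (4 * j + 8) = ε := by rw [hη]; field_simp
      have hη0 : 0 < η := by positivity
      have : 2 * (j : ℝ) * (1 / n + mcDelta n (q n) K) ≤ 2 * j * (η + η) := by
        apply mul_le_mul_of_nonneg_left _ (by positivity)
        linarith
      nlinarith
    have h2 := (ih.sub hdiff).const_mul ((j + 1 : ℝ) / (j + 2))
    refine Filter.Tendsto.congr ?_ (h2.trans (le_of_eq ?_))
    · intro n
      have : (0 : ℝ) < j + 1 := by positivity
      have : (0 : ℝ) < j + 2 := by positivity
      field_simp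
      ring
    · congr 1
      have : (0 : ℝ) < j + 1 := by positivity
      have : (0 : ℝ) < j + 2 := by positivity
      push_cast
      field_simp
      ring

lemma mc_poly (q : ℕ → ℝ) (s : ℕ → ℕ) (hq : ∀ n, 0 < q n ∧ q n < 1)
    (hlim : Filter.Tendsto (fun n : ℕ => (1 - q n) ^ 2 * (n : ℝ)) Filter.atTop (nhds 0))
    (hs : ∀ n : ℕ, 1 ≤ n → 1 ≤ s n ∧ s n ≤ n) (p : Polynomial ℝ) :
    Filter.Tendsto (fun n : ℕ => mExp n (q n) (fun π => p.eval ((cycleCardNat n π (s n) : ℝ) / n)))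
      Filter.atTop (nhds (∫ x in (0 : ℝ)..1, p.eval x)) := by
  have e1 : ∫ x in (0 : ℝ)..1, p.eval x =
      ∑ i ∈ Finset.range (p.natDegree + 1), p.coeff i * (1 / ((i : ℝ) + 1)) := by
    simp only [Polynomial.eval_eq_sum_range]
    rw [intervalIntegral.integral_finsetSum]
    · apply Finset.sum_congr rfl
      intro i _
      rw [intervalIntegral.integral_const_mul, integral_pow]
      simp
    · intro i _
      exact (by fun_prop : Continuous fun x : ℝ => p.coeff i * x ^ i).intervalIntegrable _ _
  have e2 : ∀ n : ℕ, mExp n (q n) (fun π => p.eval ((cycleCardNat n π (s n) : ℝ) / n)) =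
      ∑ i ∈ Finset.range (p.natDegree + 1), p.coeff i *
        mExp n (q n) (fun π => ((cycleCardNat n π (s n) : ℝ) / n) ^ i) := by
    intro n
    simp only [Polynomial.eval_eq_sum_range, mExp, Finset.mul_sum]
    rw [Finset.sum_comm]
    apply Finset.sum_congr rfl
    intro i _
    apply Finset.sum_congr rfl
    intro π _
    ring
  rw [e1]
  simp only [e2]
  apply tendsto_finsetSum
  intro i _
  exact (mc_moment q s hq hlim hs i).const_mul _

/-- In the regime `(1-q_n)^2 · n → 0`, the normalized cycle length `|C_{s_n}|/n`
converges in distribution to the uniform distribution on `[0,1]`: tested against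
every bounded continuous function. -/
theorem mallows_cycle_length_uniform_limit
    (q : ℕ → ℝ) (s : ℕ → ℕ)
    (hq : ∀ n, 0 < q n ∧ q n < 1)
    (hlim : Filter.Tendsto (fun n : ℕ => (1 - q n) ^ 2 * (n : ℝ))
      Filter.atTop (nhds 0))
    (hs : ∀ n : ℕ, 1 ≤ n → 1 ≤ s n ∧ s n ≤ n) :
    ∀ f : BoundedContinuousFunction ℝ ℝ,
      Filter.Tendsto
        (fun n : ℕ =>
          mExp n (q n) (fun π => f ((cycleCardNat n π (s n) : ℝ) / (n : ℝ))))
        Filter.atTop (nhds (∫ x in (0:ℝ)..1, f x)) := by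
  intro f
  rw [Metric.tendsto_atTop]
  intro ε hε
  obtain ⟨p, hp⟩ := exists_polynomial_near_of_continuousOn 0 1 f f.continuous.continuousOn
    (ε / 4) (by positivity)
  obtain ⟨N, hN⟩ := Metric.tendsto_atTop.mp (mc_poly q s hq hlim hs p) (ε / 4) (by positivity)
  refine ⟨max N 1, fun n hn => ?_⟩
  have hn1 : 1 ≤ n := le_trans (le_max_right _ _) hn
  have h1 := hN n (le_trans (le_max_left _ _) hn)
  rw [Real.dist_eq] at h1 ⊢
  have hnr : (0 : ℝ) < n := by exact_mod_cast hn1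
  have h2 : |mExp n (q n) (fun π => p.eval ((cycleCardNat n π (s n) : ℝ) / n)) -
      mExp n (q n) (fun π => f ((cycleCardNat n π (s n) : ℝ) / (n : ℝ)))| ≤ ε / 4 := by
    apply mc_exp_sub_le n (q n) (hq n).1
    intro π
    apply (hp _ ?_).le
    have hc : (cycleCardNat n π (s n) : ℝ) ≤ n := by
      have : cycleCardNat n π (s n) ≤ n := by
        unfold cycleCardNat
        exact (Finset.card_le_univ _).trans (by simp)
      exact_mod_cast this
    exact ⟨by positivity, by rw [div_le_one hnr]; exact hc⟩
  have h3 : |(∫ x in (0 : ℝ)..1, p.eval x) - ∫ x in (0 : ℝ)..1, f x| ≤ ε / 4 := by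
    rw [← intervalIntegral.integral_sub (p.continuous.intervalIntegrable _ _)
      (f.continuous.intervalIntegrable _ _)]
    have := intervalIntegral.norm_integral_le_of_norm_le_const (a := (0 : ℝ)) (b := 1)
      (f := fun x => p.eval x - f x) (C := ε / 4) (by
        intro x hx
        rw [Set.uIoc_of_le zero_le_one] at hx
        exact (hp x ⟨hx.1.le, hx.2⟩).le)
    simpa using this
  rw [abs_lt] at h1 ⊢
  rw [abs_le] at h2 h3
  constructor <;> linarith [h1.1, h1.2, h2.1, h2.2, h3.1, h3.2]
end
end

section
/- Let n ≥ 1 be an integer, 0 < q < 1, and let π have the Mallows distribution μ_{n,q}. Let 1 ≤ s ≤ n and let a_1,…,a_{s−1} be distinct elements of {1,…,n} (so the event {π(1)=a_1,…,π(s−1)=a_{s−1}} has positive probability). Let j_1 < j_2 < ⋯ < j_{n−s+1} be the elements of {1,…,n} ∖ {a_1,…,a_{s−1}}. Then for every k ∈ {1,…,n−s+1}, P[π(s) = j_k | π(1)=a_1,…,π(s−1)=a_{s−1}] = (1−q)/(1−q^{n−s+1}) · q^{k−1}. -/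
open Finset
open scoped Classical BigOperators

noncomputable section

lemma inv_eq_sum (n : ℕ) (π : Equiv.Perm (Fin n)) :
    invCount n π = ∑ i : Fin n, (univ.filter (fun r : Fin n => i < r ∧ π r < π i)).card := by
  unfold invCount
  rw [Finset.card_filter, Fintype.sum_prod_type]
  refine Finset.sum_congr rfl fun i _ => ?_
  rw [Finset.card_filter]

lemma inv_step (n : ℕ) (t : Fin n) (π : Equiv.Perm (Fin n)) (j' : Fin n)
    (hlt : π t < j') (hj' : ∀ i, i < t → π i ≠ j')
    (hb : ∀ r, t < r → ¬ (π t < π r ∧ π r < j')) :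
    invCount n (Equiv.swap (π t) j' * π) = invCount n π + 1 := by
  obtain ⟨p, rfl⟩ : ∃ p, π p = j' := ⟨π.symm j', by simp⟩
  have hp : t < p := by
    rcases lt_trichotomy t p with h | h | h
    · exact h
    · subst h; exact absurd hlt (lt_irrefl _)
    · exact absurd rfl (hj' p h)
  have hsw : ∀ r, (Equiv.swap (π t) (π p) * π) r = π (Equiv.swap t p r) := by
    intro r
    rw [Equiv.Perm.mul_apply, Equiv.swap_apply_def, Equiv.swap_apply_def]
    simp only [π.injective.eq_iff]
    split_ifs <;> rfl
  rw [inv_eq_sum, inv_eq_sum, ← Finset.add_sum_erase _ _ (mem_univ t),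
    ← Finset.add_sum_erase univ (fun i => (univ.filter (fun r : Fin n => i < r ∧ π r < π i)).card)
      (mem_univ t)]
  have h1 : (univ.filter (fun r : Fin n => t < r ∧ (Equiv.swap (π t) (π p) * π) r <
      (Equiv.swap (π t) (π p) * π) t)).card =
      (univ.filter (fun r : Fin n => t < r ∧ π r < π t)).card + 1 := by
    rw [← Finset.card_insert_of_notMem (a := p)]
    · congr 1
      ext r
      simp only [mem_filter, mem_univ, true_and, mem_insert, hsw, Equiv.swap_apply_left]
      by_cases hr : r = p
      · subst hr; simp [hp, hlt]
      · by_cases hrt : t < r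
        · rw [Equiv.swap_apply_of_ne_of_ne hrt.ne' hr]
          have := hb r hrt
          have h3 : π r ≠ π t := fun h => hrt.ne' (π.injective h)
          simp only [hrt, hr, true_and, false_or]
          constructor
          · intro h; by_contra h4; exact this ⟨lt_of_le_of_ne (not_lt.1 h4) h3.symm, h⟩
          · intro h; exact h.trans hlt
        · simp [hrt, hr]
    · simp only [mem_filter, mem_univ, true_and, not_and, not_lt]
      intro _; exact hlt.le
  have h2 : ∀ i ∈ univ.erase t, (univ.filter (fun r : Fin n => i < r ∧
      (Equiv.swap (π t) (π p) * π) r < (Equiv.swap (π t) (π p) * π) i)).card =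
      (univ.filter (fun r : Fin n => i < r ∧ π r < π i)).card := by
    intro i hi
    have hit : i ≠ t := (mem_erase.1 hi).1
    rcases lt_or_gt_of_ne hit with h | h
    · refine Finset.card_equiv (Equiv.swap t p) fun r => ?_
      simp only [mem_filter, mem_univ, true_and, hsw]
      rw [Equiv.swap_apply_of_ne_of_ne hit (h.trans hp).ne]
      have : i < Equiv.swap t p r ↔ i < r := by
        rw [Equiv.swap_apply_def]
        have := h.trans hp
        split_ifs with h5 h6
        · subst h5; simp [h, this]
        · subst h6; simp [h, this]
        · rfl
      rw [this]
    · congr 1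
      ext r
      simp only [mem_filter, mem_univ, true_and, hsw]
      refine and_congr_right fun hr => ?_
      have hrt := h.trans hr
      have b1 := hb r hrt
      have b2 := hb i h
      have c1 : π r ≠ π t := fun h => hrt.ne' (π.injective h)
      have c2 : π i ≠ π t := fun h => hit (π.injective h)
      have c3 : π r = π p ↔ r = p := π.injective.eq_iff
      have c4 : π i = π p ↔ i = p := π.injective.eq_iff
      rw [Equiv.swap_apply_def, Equiv.swap_apply_def]
      rw [if_neg hrt.ne', if_neg hit]
      split_ifs with h5 h6 h6
      · subst h5 h6; simp
      · subst h5; grind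
      · subst h6; grind
      · rfl
  rw [h1, Finset.sum_congr rfl h2]
  ring

/-- Total weight of permutations with the given prefix and `π t = j`. -/
def wt (n : ℕ) (q : ℝ) (a : Fin n → Fin n) (t : Fin n) (j : Fin n) : ℝ :=
  ∑ π : Equiv.Perm (Fin n), if π t = j ∧ (∀ i, i < t → π i = a i) then q ^ invCount n π else 0

lemma wt_step (n : ℕ) (q : ℝ) (a : Fin n → Fin n) (t j j' : Fin n)
    (hlt : j < j') (hj : ∀ i, i < t → a i ≠ j) (hj' : ∀ i, i < t → a i ≠ j')
    (hb : ∀ v, j < v → v < j' → ∃ i, i < t ∧ a i = v) :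
    wt n q a t j' = q * wt n q a t j := by
  unfold wt
  rw [Finset.mul_sum]
  symm
  refine Fintype.sum_equiv (Equiv.mulLeft (Equiv.swap j j')) _ _ fun π => ?_
  rw [show (Equiv.mulLeft (Equiv.swap j j')) π = Equiv.swap j j' * π from rfl]
  have hc : ((Equiv.swap j j' * π) t = j' ∧ ∀ i, i < t → (Equiv.swap j j' * π) i = a i) ↔
      (π t = j ∧ ∀ i, i < t → π i = a i) := by
    simp only [Equiv.Perm.mul_apply]
    refine and_congr ?_ (forall_congr' fun i => forall_congr' fun hi => ?_)
    · rw [Equiv.swap_apply_eq_iff, Equiv.swap_apply_right]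
    · rw [Equiv.swap_apply_eq_iff, Equiv.swap_apply_of_ne_of_ne (hj i hi) (hj' i hi)]
  by_cases h : π t = j ∧ ∀ i, i < t → π i = a i
  · rw [if_pos h, if_pos (hc.2 h)]
    obtain ⟨rfl, h2⟩ := h
    rw [inv_step n t π j' hlt (fun i hi => by rw [h2 i hi]; exact hj' i hi), pow_succ, mul_comm]
    rintro r hr ⟨h3, h4⟩
    obtain ⟨i, hi, h5⟩ := hb _ h3 h4
    rw [← h2 i hi] at h5
    have := π.injective h5
    subst this
    exact absurd hi (not_lt.2 hr.le)
  · rw [if_neg h, if_neg (fun h' => h (hc.1 h')), mul_zero]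

/-- The sequential sampling formula for the Mallows distribution: conditioned on the
first `t = s-1` values `π(1)=a_1,…,π(t)=a_t`, the next value `π(t+1)` equals the `k`-th
smallest element `j` of the complement with probability `(1-q)/(1-q^{n-t}) · q^{k-1}`. -/
theorem mallows_sampling_formula
    (n : ℕ) (q : ℝ) (h0 : 0 < q) (h1 : q < 1)
    (t : ℕ) (ht : t < n) (a : Fin n → Fin n)
    (ha : ∀ i i' : Fin n, (i : ℕ) < t → (i' : ℕ) < t → a i = a i' → i = i')
    (j : Fin n) (hj : ∀ i : Fin n, (i : ℕ) < t → a i ≠ j)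
    (k : ℕ)
    (hk : k = (Finset.univ.filter
      (fun j' : Fin n => (∀ i : Fin n, (i : ℕ) < t → a i ≠ j') ∧ j' ≤ j)).card) :
    mCondProb n q (fun π => π ⟨t, ht⟩ = j)
        (fun π => ∀ i : Fin n, (i : ℕ) < t → π i = a i)
      = (1 - q) / (1 - q ^ (n - t)) * q ^ (k - 1) := by
  set T : Fin n := ⟨t, ht⟩ with hT
  have hlt : ∀ i : Fin n, (i : ℕ) < t ↔ i < T := fun i => Iff.rfl
  simp only [hlt] at *
  set S : Finset (Fin n) := univ.filter (fun v => ∀ i, i < T → a i ≠ v) with hS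
  have hSmem : ∀ v, v ∈ S ↔ ∀ i, i < T → a i ≠ v := fun v => by simp [hS]
  have hScard : S.card = n - t := by
    have h1 : S = univ \ (Finset.Iio T).image a := by
      ext v; simp [hS]
    rw [h1, Finset.card_sdiff_of_subset (subset_univ _), Finset.card_image_of_injOn]
    · simp [hT]
    · intro x hx y hy hxy
      exact ha x y (by simpa using hx) (by simpa using hy) hxy
  have hm : 0 < n - t := by omega
  set e := S.orderEmbOfFin hScard with he
  have heS : ∀ i, e i ∈ S := fun i => S.orderEmbOfFin_mem hScard i
  have hsurj : ∀ v ∈ S, ∃ i, e i = v := fun v hv => by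
    have := S.range_orderEmbOfFin hScard
    have h2 : v ∈ Set.range e := by rw [this]; exact hv
    exact h2
  set C := wt n q a T (e ⟨0, hm⟩) with hC
  have hW : ∀ i (hi : i < n - t), wt n q a T (e ⟨i, hi⟩) = q ^ i * C := by
    intro i
    induction i with
    | zero => intro hi; simp [hC]
    | succ i ih =>
      intro hi
      rw [wt_step n q a T (e ⟨i, by omega⟩) (e ⟨i+1, hi⟩) (e.strictMono (by simp [Fin.lt_def]))
        ((hSmem _).1 (heS _)) ((hSmem _).1 (heS _)), ih, pow_succ]
      · ring
      · intro v h1 h2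
        by_contra h3
        push Not at h3
        obtain ⟨l, rfl⟩ := hsurj v ((hSmem v).2 h3)
        rw [e.lt_iff_lt, Fin.lt_def] at h1 h2
        simp only at h1 h2
        omega
  obtain ⟨l, rfl⟩ := hsurj j ((hSmem j).2 hj)
  have hkl : k = l + 1 := by
    rw [hk]
    have : (univ.filter (fun j' : Fin n => (∀ i, i < T → a i ≠ j') ∧ j' ≤ e l)) =
        (Finset.Iic l).map e.toEmbedding := by
      ext v
      simp only [mem_filter, mem_univ, true_and, mem_map, mem_Iic]
      constructor
      · rintro ⟨h1, h2⟩
        obtain ⟨i, rfl⟩ := hsurj v ((hSmem v).2 h1)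
        exact ⟨i, e.le_iff_le.1 h2, rfl⟩
      · rintro ⟨i, h1, rfl⟩
        exact ⟨(hSmem _).1 (heS _), e.le_iff_le.2 h1⟩
    rw [this, Finset.card_map, Fin.card_Iic]
  have hZ : 0 < mallowsZ n q := Finset.sum_pos (fun _ _ => pow_pos h0 _) ⟨1, mem_univ _⟩
  have hnum : mProb n q (fun π => π T = e l ∧ ∀ i, i < T → π i = a i) =
      q ^ (l : ℕ) * C / mallowsZ n q := by
    rw [← hW l l.2]
    unfold mProb wt mallowsP
    rw [Finset.sum_div]
    refine Finset.sum_congr rfl fun π _ => ?_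
    simp only [ite_div, zero_div]
    by_cases hB : π T = e l ∧ ∀ i, i < T → π i = a i
    · rw [if_pos hB]; exact (if_pos hB).symm
    · rw [if_neg hB]; exact (if_neg hB).symm
  have hden : mProb n q (fun π => ∀ i, i < T → π i = a i) =
      (∑ i ∈ range (n - t), q ^ i) * C / mallowsZ n q := by
    have h1 : (∑ i ∈ range (n - t), q ^ i) * C = ∑ v ∈ S, wt n q a T v := by
      rw [Finset.sum_mul, Finset.sum_range, ← S.map_orderEmbOfFin_univ hScard, Finset.sum_map]
      exact Finset.sum_congr rfl fun i _ => (hW i i.2).symm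
    rw [h1]
    unfold mProb wt mallowsP
    rw [Finset.sum_comm, Finset.sum_div]
    refine Finset.sum_congr rfl fun π _ => ?_
    by_cases hB : ∀ i, i < T → π i = a i
    · have hTS : π T ∈ S := by
        rw [hSmem]
        intro i hi h
        rw [← hB i hi] at h
        exact hi.ne (π.injective h)
      rw [if_pos hB]
      rw [Finset.sum_eq_single (π T), if_pos ⟨rfl, hB⟩]
      · intro v _ hv
        exact if_neg fun h => hv h.1.symm
      · intro h
        exact absurd hTS h
    · simp [hB]
  have hpos : 0 < mProb n q (fun π => ∀ i, i < T → π i = a i) := by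
    obtain ⟨g, hg⟩ := Finset.exists_equiv_extend_of_card_eq (α := Fin n) (t := (univ : Finset (Fin n)))
      (by simp) (s := Finset.Iio T) (f := a) (subset_univ _) (by
        intro x hx y hy hxy
        exact ha x y (by simpa using hx) (by simpa using hy) hxy)
    unfold mProb
    have hP : ∀ π, 0 < mallowsP n q π := fun π => div_pos (pow_pos h0 _) hZ
    refine Finset.sum_pos' (fun π _ => ?_)
      ⟨g.trans (Equiv.subtypeUnivEquiv (fun x => mem_univ x)), mem_univ _, ?_⟩
    · split_ifs
      · exact (hP π).le
      · exact le_rfl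
    · rw [if_pos]
      · exact hP _
      · intro i hi
        exact hg i (by simpa using hi)
  rw [hden] at hpos
  have hC0 : C ≠ 0 := by
    rintro h; rw [h] at hpos; simp at hpos
  unfold mCondProb
  rw [hnum, hden, hkl, Nat.add_sub_cancel, geom_sum_eq h1.ne]
  have hq1 : q ^ (n - t) < 1 := pow_lt_one₀ h0.le h1 hm.ne'
  have e1 : 1 - q ≠ 0 := by linarith
  have e2 : 1 - q ^ (n - t) ≠ 0 := by linarith
  have e3 : q - 1 ≠ 0 := by linarith
  have e4 : q ^ (n - t) - 1 ≠ 0 := by linarith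
  have hZ' := hZ.ne'
  rw [show (q ^ (n - t) - 1) / (q - 1) = (1 - q ^ (n - t)) / (1 - q) by
    rw [← neg_sub 1 q, ← neg_sub 1 (q ^ (n - t)), neg_div_neg_eq]]
  field_simp
end
end

section
/- Let n ≥ 1 be an integer, 0 < q < 1, and let π have the Mallows distribution μ_{n,q}. Fix i, j ∈ {1,…,n} and let g be any subset of {(x,y) ∈ {1,…,n}² : x < i, y < j} with P[Γ_π ∩ {x<i, y<j} = g] > 0. Then, conditionally on the event {Γ_π ∩ {x<i, y<j} = g}, the random sets Γ_π ∩ {x ≥ i, y < j} and Γ_π ∩ {x < i, y ≥ j} are independent; i.e., for all sets a ⊆ {(x,y) : x ≥ i, y < j} and b ⊆ {(x,y) : x < i, y ≥ j}, P[Γ_π∩{x≥i,y<j} = a and Γ_π∩{x<i,y≥j} = b | Γ_π∩{x<i,y<j} = g] = P[Γ_π∩{x≥i,y<j} = a | Γ_π∩{x<i,y<j} = g] · P[Γ_π∩{x<i,y≥j} = b | Γ_π∩{x<i,y<j} = g]. -/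
open Finset
open scoped Classical BigOperators

noncomputable section

/-- The graph `Γ_π = {(s, π(s))}` of a permutation, as a subset of `Fin n × Fin n`. -/
def graphP (n : ℕ) (π : Equiv.Perm (Fin n)) : Finset (Fin n × Fin n) :=
  Finset.univ.filter (fun p => π p.1 = p.2)

/-- Two permutations whose graphs agree on the lower-left box are related by a relabelling of the
positions `≥ i`, carrying the lower-right part of the one to that of the other and monotone on the
upper-right part. -/
lemma exists_rho {n : ℕ} (i j : Fin n) (π₁ π₂ : Equiv.Perm (Fin n))
    (h : ∀ x y, x < i → y < j → (π₁ x = y ↔ π₂ x = y)) :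
    ∃ ρ : Equiv.Perm (Fin n), (∀ x, x < i → ρ x = x) ∧ (∀ x, i ≤ x → i ≤ ρ x) ∧
      (∀ x y, i ≤ x → y < j → (π₂ x = y ↔ π₁ (ρ x) = y)) ∧
      (∀ s t, i ≤ s → i ≤ t → j ≤ π₂ s → j ≤ π₂ t → (s < t ↔ ρ s < ρ t)) := by
  have back : ∀ x, i ≤ x → π₂ x < j → i ≤ π₁.symm (π₂ x) := by
    intro x hx hy
    by_contra hc
    push Not at hc
    have h2 := (h _ _ hc hy).1 (by simp)
    have h3 := π₂.injective h2
    rw [h3] at hc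
    exact absurd hc (not_lt.2 hx)
  have back' : ∀ x, i ≤ x → π₁ x < j → i ≤ π₂.symm (π₁ x) := by
    intro x hx hy
    by_contra hc
    push Not at hc
    have h2 := (h _ _ hc hy).2 (by simp)
    have h3 := π₁.injective h2
    rw [h3] at hc
    exact absurd hc (not_lt.2 hx)
  let D : Equiv.Perm (Fin n) → Finset (Fin n) := fun π => univ.filter (fun x => i ≤ x ∧ j ≤ π x)
  let B : Equiv.Perm (Fin n) → Finset (Fin n) := fun π => univ.filter (fun x => i ≤ x ∧ π x < j)
  have hBcard : (B π₂).card = (B π₁).card := by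
    refine Finset.card_bij (fun x _ => π₁.symm (π₂ x)) ?_ ?_ ?_
    · intro x hx
      simp only [B, mem_filter, mem_univ, true_and] at hx ⊢
      exact ⟨back x hx.1 hx.2, by simpa using hx.2⟩
    · intro x _ y _ hxy
      simpa using hxy
    · intro y hy
      simp only [B, mem_filter, mem_univ, true_and] at hy
      refine ⟨π₂.symm (π₁ y), ?_, by simp⟩
      simp only [B, mem_filter, mem_univ, true_and]
      exact ⟨back' y hy.1 hy.2, by simpa using hy.2⟩
  have hsum : ∀ π, (B π).card + (D π).card = (univ.filter (fun x : Fin n => i ≤ x)).card := by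
    intro π
    rw [← Finset.card_filter_add_card_filter_not (s := univ.filter (fun x : Fin n => i ≤ x))
      (fun x => π x < j)]
    simp only [B, D, Finset.filter_filter, not_lt]
  have hDcard : (D π₂).card = (D π₁).card := by
    have := hsum π₁
    have := hsum π₂
    omega
  let e : D π₂ ≃o D π₁ :=
    ((D π₂).orderIsoOfFin rfl).symm.trans ((D π₁).orderIsoOfFin hDcard.symm)
  have hmem : ∀ π x, x ∈ D π ↔ i ≤ x ∧ j ≤ π x := by
    intro π x
    simp [D]
  let f : Fin n → Fin n := fun x =>
    if x < i then x else if hx : x ∈ D π₂ then (e ⟨x, hx⟩ : Fin n) else π₁.symm (π₂ x)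
  have f1 : ∀ x, x < i → f x = x := fun x hx => by simp [f, hx]
  have f2 : ∀ x (hx : x ∈ D π₂), f x = e ⟨x, hx⟩ := fun x hx => by
    have h1 : ¬ x < i := not_lt.2 ((hmem _ _).1 hx).1
    simp only [f, h1, if_false, hx, dif_pos]
  have f2' : ∀ x, x ∈ D π₂ → i ≤ f x ∧ j ≤ π₁ (f x) := fun x hx => by
    rw [f2 x hx]
    exact (hmem _ _).1 (e ⟨x, hx⟩).2
  have f3 : ∀ x, i ≤ x → π₂ x < j → f x = π₁.symm (π₂ x) := fun x hx hy => by
    have h1 : ¬ x < i := not_lt.2 hx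
    have h2 : x ∉ D π₂ := by
      rw [hmem]
      exact fun h => absurd hy (not_lt.2 h.2)
    simp only [f, h1, if_false, h2, dif_neg, not_false_eq_true]
  have f3' : ∀ x, i ≤ x → π₂ x < j → i ≤ f x ∧ π₁ (f x) = π₂ x := fun x hx hy => by
    rw [f3 x hx hy]
    exact ⟨back x hx hy, by simp⟩
  have hge : ∀ x, i ≤ x → i ≤ f x := by
    intro x hx
    rcases lt_or_ge (π₂ x) j with hy | hy
    · exact (f3' x hx hy).1
    · exact (f2' x ((hmem _ _).2 ⟨hx, hy⟩)).1
  have hinj : Function.Injective f := by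
    intro x y hxy
    rcases lt_or_ge x i with hx | hx <;> rcases lt_or_ge y i with hy | hy
    · rwa [f1 x hx, f1 y hy] at hxy
    · have := hge y hy
      rw [← hxy, f1 x hx] at this
      exact absurd hx (not_lt.2 this)
    · have := hge x hx
      rw [hxy, f1 y hy] at this
      exact absurd hy (not_lt.2 this)
    · rcases lt_or_ge (π₂ x) j with hx2 | hx2 <;> rcases lt_or_ge (π₂ y) j with hy2 | hy2
      · rw [f3 x hx hx2, f3 y hy hy2] at hxy
        simpa using hxy
      · have h4 := (f2' y ((hmem _ _).2 ⟨hy, hy2⟩)).2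
        rw [← hxy, (f3' x hx hx2).2] at h4
        exact absurd hx2 (not_lt.2 h4)
      · have h4 := (f2' x ((hmem _ _).2 ⟨hx, hx2⟩)).2
        rw [hxy, (f3' y hy hy2).2] at h4
        exact absurd hy2 (not_lt.2 h4)
      · rw [f2 x ((hmem _ _).2 ⟨hx, hx2⟩), f2 y ((hmem _ _).2 ⟨hy, hy2⟩)] at hxy
        have := e.injective (Subtype.ext hxy)
        simpa using this
  refine ⟨Equiv.ofBijective f (Finite.injective_iff_bijective.1 hinj), f1, hge, ?_, ?_⟩
  · intro x y hx hy
    simp only [Equiv.ofBijective_apply]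
    rcases lt_or_ge (π₂ x) j with hx2 | hx2
    · rw [(f3' x hx hx2).2]
    · have h4 := (f2' x ((hmem _ _).2 ⟨hx, hx2⟩)).2
      constructor
      · intro h5
        rw [h5] at hx2
        exact absurd hy (not_lt.2 hx2)
      · intro h5
        rw [h5] at h4
        exact absurd hy (not_lt.2 h4)
  · intro s t hs ht hs2 ht2
    simp only [Equiv.ofBijective_apply]
    rw [f2 s ((hmem _ _).2 ⟨hs, hs2⟩), f2 t ((hmem _ _).2 ⟨ht, ht2⟩), Subtype.coe_lt_coe,
      e.lt_iff_lt]
    simp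

/-- The inversions between positions `≥ i` whose lower point has height `< j`. -/
def kCount {n : ℕ} (i j : Fin n) (π : Equiv.Perm (Fin n)) : ℕ :=
  ((Finset.univ : Finset (Fin n × Fin n)).filter
    (fun p => (p.1 < p.2 ∧ π p.2 < π p.1) ∧ (i ≤ p.1 ∧ π p.2 < j))).card

/-- The remaining inversions. -/
def lCount {n : ℕ} (i j : Fin n) (π : Equiv.Perm (Fin n)) : ℕ :=
  ((Finset.univ : Finset (Fin n × Fin n)).filter
    (fun p => (p.1 < p.2 ∧ π p.2 < π p.1) ∧ ¬ (i ≤ p.1 ∧ π p.2 < j))).card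

lemma invCount_split {n : ℕ} (i j : Fin n) (π : Equiv.Perm (Fin n)) :
    invCount n π = kCount i j π + lCount i j π := by
  unfold invCount kCount lCount
  rw [← Finset.card_filter_add_card_filter_not (fun p : Fin n × Fin n => i ≤ p.1 ∧ π p.2 < j),
    Finset.filter_filter, Finset.filter_filter]

lemma kCount_congr {n : ℕ} (i j : Fin n) (π σ : Equiv.Perm (Fin n))
    (h : ∀ x y, i ≤ x → y < j → (π x = y ↔ σ x = y)) : kCount i j π = kCount i j σ := by
  have key : ∀ π σ : Equiv.Perm (Fin n), (∀ x y, i ≤ x → y < j → (π x = y ↔ σ x = y)) →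
      ∀ p : Fin n × Fin n, ((p.1 < p.2 ∧ π p.2 < π p.1) ∧ (i ≤ p.1 ∧ π p.2 < j)) →
      ((p.1 < p.2 ∧ σ p.2 < σ p.1) ∧ (i ≤ p.1 ∧ σ p.2 < j)) := by
    rintro π σ h ⟨s, t⟩ ⟨⟨h1, h2⟩, h3, h4⟩
    have ht : σ t = π t := (h t _ (h3.trans h1.le) h4).1 rfl
    dsimp only at *
    rw [ht]
    refine ⟨⟨h1, ?_⟩, h3, h4⟩
    by_contra hc
    push Not at hc
    have hs := (h s (σ s) h3 (lt_of_le_of_lt hc h4)).2 rfl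
    rw [hs] at h2
    exact absurd h2 (not_lt.2 hc)
  unfold kCount
  congr 1
  ext p
  simp only [mem_filter, mem_univ, true_and]
  exact ⟨key π σ h p, key σ π (fun x y hx hy => (h x y hx hy).symm) p⟩

lemma lCount_mul {n : ℕ} (i j : Fin n) (π ρ : Equiv.Perm (Fin n))
    (r1 : ∀ x, x < i → ρ x = x) (r2 : ∀ x, i ≤ x → i ≤ ρ x)
    (r4 : ∀ s t, i ≤ s → i ≤ t → j ≤ π (ρ s) → j ≤ π (ρ t) → (s < t ↔ ρ s < ρ t)) :
    lCount i j (π * ρ) = lCount i j π := by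
  unfold lCount
  refine Finset.card_equiv (Equiv.prodCongr ρ ρ) ?_
  rintro ⟨s, t⟩
  rw [mem_filter, mem_filter]
  simp only [mem_univ, true_and, Equiv.prodCongr_apply, Prod.map_apply,
    Equiv.Perm.coe_mul, Function.comp_apply]
  rcases lt_or_ge s i with hs | hs <;> rcases lt_or_ge t i with ht | ht
  · simp only [r1 s hs, r1 t ht]
  · have := r2 t ht
    simp only [r1 s hs]
    have a1 : s < t := lt_of_lt_of_le hs ht
    have a2 : s < ρ t := lt_of_lt_of_le hs this
    simp [a1, a2]
  · have := r2 s hs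
    simp only [r1 t ht]
    have a1 : ¬ s < t := not_lt.2 (ht.le.trans hs)
    have a2 : ¬ ρ s < t := not_lt.2 (ht.le.trans this)
    simp [a1, a2]
  · have hs' := r2 s hs
    have r := r4 s t hs ht
    simp only [hs, hs', true_and, not_lt]
    constructor
    · rintro ⟨⟨h1, h2⟩, h3⟩
      exact ⟨⟨(r (h3.trans h2.le) h3).1 h1, h2⟩, h3⟩
    · rintro ⟨⟨h1, h2⟩, h3⟩
      exact ⟨⟨(r (h3.trans h2.le) h3).2 h1, h2⟩, h3⟩

lemma box_eq_iff {n : ℕ} (π σ : Equiv.Perm (Fin n)) (R : Fin n × Fin n → Prop)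
    [DecidablePred R] :
    graphP n π ∩ univ.filter R = graphP n σ ∩ univ.filter R ↔
      ∀ x y, R (x, y) → (π x = y ↔ σ x = y) := by
  rw [Finset.ext_iff]
  simp only [graphP, mem_inter, mem_filter, mem_univ, true_and, Prod.forall]
  constructor
  · intro h x y hR
    have := h x y
    tauto
  · intro h x y
    have := h x y
    tauto

def boxA {n : ℕ} (i j : Fin n) (π : Equiv.Perm (Fin n)) : Finset (Fin n × Fin n) :=
  graphP n π ∩ univ.filter (fun p : Fin n × Fin n => p.1 < i ∧ p.2 < j)

def boxB {n : ℕ} (i j : Fin n) (π : Equiv.Perm (Fin n)) : Finset (Fin n × Fin n) :=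
  graphP n π ∩ univ.filter (fun p : Fin n × Fin n => i ≤ p.1 ∧ p.2 < j)

def boxC {n : ℕ} (i j : Fin n) (π : Equiv.Perm (Fin n)) : Finset (Fin n × Fin n) :=
  graphP n π ∩ univ.filter (fun p : Fin n × Fin n => p.1 < i ∧ j ≤ p.2)

lemma boxA_iff {n : ℕ} (i j : Fin n) (π σ : Equiv.Perm (Fin n)) :
    boxA i j π = boxA i j σ ↔ ∀ x y, x < i ∧ y < j → (π x = y ↔ σ x = y) := by
  exact box_eq_iff π σ (fun p => p.1 < i ∧ p.2 < j)

lemma boxB_iff {n : ℕ} (i j : Fin n) (π σ : Equiv.Perm (Fin n)) :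
    boxB i j π = boxB i j σ ↔ ∀ x y, i ≤ x ∧ y < j → (π x = y ↔ σ x = y) := by
  exact box_eq_iff π σ (fun p => i ≤ p.1 ∧ p.2 < j)

lemma boxC_iff {n : ℕ} (i j : Fin n) (π σ : Equiv.Perm (Fin n)) :
    boxC i j π = boxC i j σ ↔ ∀ x y, x < i ∧ j ≤ y → (π x = y ↔ σ x = y) := by
  exact box_eq_iff π σ (fun p => p.1 < i ∧ j ≤ p.2)

lemma ratio {n : ℕ} (q : ℝ) (i j : Fin n) (π₁ π₂ : Equiv.Perm (Fin n))
    (hA : boxA i j π₁ = boxA i j π₂) (Q : Finset (Fin n × Fin n) → Prop) :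
    mProb n q (fun π => boxB i j π = boxB i j π₂ ∧ Q (boxC i j π) ∧ boxA i j π = boxA i j π₂)
        * q ^ kCount i j π₁ =
      mProb n q (fun π => boxB i j π = boxB i j π₁ ∧ Q (boxC i j π) ∧ boxA i j π = boxA i j π₂)
        * q ^ kCount i j π₂ := by
  obtain ⟨ρ, r1, r2, r3, r4⟩ := exists_rho i j π₁ π₂
    (fun x y hx hy => (boxA_iff i j π₁ π₂).1 hA x y ⟨hx, hy⟩)
  unfold mProb
  rw [Finset.sum_mul, Finset.sum_mul]
  symm
  refine Fintype.sum_equiv (Equiv.mulRight ρ) _ _ ?_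
  intro π
  have hE : (Equiv.mulRight ρ) π = π * ρ := rfl
  rw [hE]
  have hAA : boxA i j (π * ρ) = boxA i j π := by
    refine (boxA_iff _ _ _ _).2 ?_
    rintro x y ⟨hx, hy⟩
    simp [r1 x hx]
  have hCC : boxC i j (π * ρ) = boxC i j π := by
    refine (boxC_iff _ _ _ _).2 ?_
    rintro x y ⟨hx, hy⟩
    simp [r1 x hx]
  have hBB : boxB i j π = boxB i j π₁ ↔ boxB i j (π * ρ) = boxB i j π₂ := by
    rw [boxB_iff, boxB_iff]
    constructor
    · rintro h x y ⟨hx, hy⟩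
      rw [r3 x y hx hy]
      exact h (ρ x) y ⟨r2 x hx, hy⟩
    · rintro h x y ⟨hx, hy⟩
      obtain ⟨x, rfl⟩ := ρ.surjective x
      have hx' : i ≤ x := by
        by_contra hc
        push Not at hc
        rw [r1 x hc] at hx
        exact absurd hc (not_lt.2 hx)
      rw [← r3 x y hx' hy]
      exact h x y ⟨hx', hy⟩
  have hiff : (boxB i j π = boxB i j π₁ ∧ Q (boxC i j π) ∧ boxA i j π = boxA i j π₂) ↔
      (boxB i j (π * ρ) = boxB i j π₂ ∧ Q (boxC i j (π * ρ)) ∧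
        boxA i j (π * ρ) = boxA i j π₂) := by
    rw [hAA, hCC, ← hBB]
  by_cases hc : boxB i j π = boxB i j π₁ ∧ Q (boxC i j π) ∧ boxA i j π = boxA i j π₂
  · rw [if_pos hc, if_pos (hiff.1 hc)]
    have hb1 := (boxB_iff _ _ _ _).1 hc.1
    have hb2 := (boxB_iff _ _ _ _).1 (hBB.1 hc.1)
    have k1 : kCount i j π = kCount i j π₁ := kCount_congr i j _ _ fun x y hx hy =>
      hb1 x y ⟨hx, hy⟩
    have k2 : kCount i j (π * ρ) = kCount i j π₂ := kCount_congr i j _ _ fun x y hx hy =>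
      hb2 x y ⟨hx, hy⟩
    have l : lCount i j (π * ρ) = lCount i j π := by
      refine lCount_mul i j π ρ r1 r2 ?_
      have up : ∀ x, i ≤ x → j ≤ π (ρ x) → j ≤ π₂ x := by
        intro x hx hy
        by_contra hc
        push Not at hc
        have := (hb2 x _ ⟨hx, hc⟩).2 rfl
        rw [Equiv.Perm.mul_apply] at this
        rw [this] at hy
        exact absurd hc (not_lt.2 hy)
      intro s t hs ht hs2 ht2
      exact r4 s t hs ht (up s hs hs2) (up t ht ht2)
    unfold mallowsP
    rw [invCount_split i j (π * ρ), invCount_split i j π, k1, k2, l, pow_add, pow_add]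
    ring
  · rw [if_neg hc, if_neg (fun h => hc (hiff.2 h))]
    simp

lemma mProb_zero {n : ℕ} (q : ℝ) (A : Equiv.Perm (Fin n) → Prop) (h : ∀ π, ¬ A π) :
    mProb n q A = 0 := by
  simp [mProb, h]

lemma mProb_total {n : ℕ} (q : ℝ) (i j : Fin n) (A : Equiv.Perm (Fin n) → Prop) :
    mProb n q A = ∑ a : Finset (Fin n × Fin n), mProb n q (fun π => boxB i j π = a ∧ A π) := by
  unfold mProb
  rw [Finset.sum_comm]
  refine Finset.sum_congr rfl fun π _ => ?_
  by_cases hA : A π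
  · rw [Finset.sum_eq_single (boxB i j π)]
    · rw [if_pos hA, if_pos ⟨rfl, hA⟩]
    · intro a _ ha
      exact if_neg fun h => ha h.1.symm
    · intro h
      exact absurd (Finset.mem_univ _) h
  · rw [if_neg hA]
    exact (Finset.sum_eq_zero fun a _ => if_neg fun h => hA h.2).symm

lemma cross {n : ℕ} (q : ℝ) (h0 : 0 < q) (i j : Fin n) (g a a' : Finset (Fin n × Fin n))
    (Q Q' : Finset (Fin n × Fin n) → Prop) :
    mProb n q (fun π => boxB i j π = a ∧ Q (boxC i j π) ∧ boxA i j π = g) *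
      mProb n q (fun π => boxB i j π = a' ∧ Q' (boxC i j π) ∧ boxA i j π = g) =
    mProb n q (fun π => boxB i j π = a ∧ Q' (boxC i j π) ∧ boxA i j π = g) *
      mProb n q (fun π => boxB i j π = a' ∧ Q (boxC i j π) ∧ boxA i j π = g) := by
  by_cases e1 : ∃ π, boxB i j π = a ∧ boxA i j π = g
  · by_cases e2 : ∃ π, boxB i j π = a' ∧ boxA i j π = g
    · obtain ⟨π₁, rfl, hg1⟩ := e1
      obtain ⟨π₂, rfl, rfl⟩ := e2
      have x1 := ratio q i j π₁ π₂ hg1 Q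
      have x2 := ratio q i j π₁ π₂ hg1 Q'
      have p1 : q ^ kCount i j π₁ ≠ 0 := (pow_pos h0 _).ne'
      apply mul_right_cancel₀ p1
      rw [mul_assoc, mul_assoc, x1, x2]
      ring
    · push Not at e2
      rw [mProb_zero q (fun π => boxB i j π = a' ∧ Q' (boxC i j π) ∧ boxA i j π = g)
          (fun π h => e2 π h.1 h.2.2),
        mProb_zero q (fun π => boxB i j π = a' ∧ Q (boxC i j π) ∧ boxA i j π = g)
          (fun π h => e2 π h.1 h.2.2)]
      simp
  · push Not at e1
    rw [mProb_zero q (fun π => boxB i j π = a ∧ Q' (boxC i j π) ∧ boxA i j π = g)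
        (fun π h => e1 π h.1 h.2.2),
      mProb_zero q (fun π => boxB i j π = a ∧ Q (boxC i j π) ∧ boxA i j π = g)
        (fun π h => e1 π h.1 h.2.2)]
    simp

theorem mallows_conditional_independence
    (n : ℕ) (q : ℝ) (h0 : 0 < q) (h1 : q < 1) (i j : Fin n)
    (g : Finset (Fin n × Fin n))
    (hg : ∀ p ∈ g, p.1 < i ∧ p.2 < j)
    (hpos : 0 < mProb n q (fun π =>
      graphP n π ∩
        Finset.univ.filter (fun p : Fin n × Fin n => p.1 < i ∧ p.2 < j) = g)) :
    ∀ a b : Finset (Fin n × Fin n),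
      mCondProb n q
          (fun π =>
            graphP n π ∩
              Finset.univ.filter (fun p : Fin n × Fin n => i ≤ p.1 ∧ p.2 < j) = a ∧
            graphP n π ∩
              Finset.univ.filter (fun p : Fin n × Fin n => p.1 < i ∧ j ≤ p.2) = b)
          (fun π => graphP n π ∩
            Finset.univ.filter (fun p : Fin n × Fin n => p.1 < i ∧ p.2 < j) = g)
        =
      mCondProb n q
          (fun π => graphP n π ∩
            Finset.univ.filter (fun p : Fin n × Fin n => i ≤ p.1 ∧ p.2 < j) = a)
          (fun π => graphP n π ∩
            Finset.univ.filter (fun p : Fin n × Fin n => p.1 < i ∧ p.2 < j) = g) *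
      mCondProb n q
          (fun π => graphP n π ∩
            Finset.univ.filter (fun p : Fin n × Fin n => p.1 < i ∧ j ≤ p.2) = b)
          (fun π => graphP n π ∩
            Finset.univ.filter (fun p : Fin n × Fin n => p.1 < i ∧ p.2 < j) = g) := by
  intro a b
  unfold mCondProb
  have key : mProb n q (fun π => boxB i j π = a ∧ boxC i j π = b ∧ boxA i j π = g) *
      mProb n q (fun π => boxA i j π = g) =
      mProb n q (fun π => boxB i j π = a ∧ boxA i j π = g) *
      mProb n q (fun π => boxC i j π = b ∧ boxA i j π = g) := by
    rw [mProb_total q i j (fun π => boxA i j π = g),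
      mProb_total q i j (fun π => boxC i j π = b ∧ boxA i j π = g), Finset.mul_sum, Finset.mul_sum]
    refine Finset.sum_congr rfl fun a' _ => ?_
    have := cross q h0 i j g a a' (fun c => c = b) (fun _ => True)
    simpa only [true_and] using this
  unfold boxA boxB boxC at key
  rw [div_mul_div_comm, div_eq_div_iff hpos.ne' (mul_pos hpos hpos).ne']
  simp only [and_assoc]
  rw [← mul_assoc]
  rw [key]
end
end
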